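/- arXiv:2405.15543 — 2 statements merged into one kernel-verified Lean document; each statement's English description precedes it below -/
import Mathlib

section
/- Every finite simple graph that does not contain an induced subdivision of the house does not contain Γ_{2,2,3} as an induced minor. -/
open SimpleGraph

/-! ### Minimal separators, tame and feral classes -/

/-- `S` separates `a` from `b` in `G`: `a, b` lie in distinct connected components of `G − S`,
i.e. every walk from `a` to `b` meets `S`. -/
def Separates {V : Type} (G : SimpleGraph V) (S : Set V) (a b : V) : Prop :=
  ∀ p : G.Walk a b, ∃ x ∈ p.support, x ∈ S

/-- `S` is a minimal separator of `G`: some nonadjacent pair `a, b` outside `S` lies in distinct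
components of `G − S`, while for every proper subset `S' ⊊ S` they lie in the same component
of `G − S'`. -/
def IsMinimalSeparator {V : Type} (G : SimpleGraph V) (S : Set V) : Prop :=
  ∃ a b : V, a ∉ S ∧ b ∉ S ∧ a ≠ b ∧ ¬ G.Adj a b ∧ Separates G S a b ∧
    ∀ S' : Set V, S' ⊂ S → ¬ Separates G S' a b

/-- The number of minimal separators of a graph on `Fin n`. -/
noncomputable def numMinSep {n : ℕ} (G : SimpleGraph (Fin n)) : ℕ :=
  {S : Set (Fin n) | IsMinimalSeparator G S}.ncard

/-- A class of finite simple graphs (one collection for each number of vertices) is tame if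
some polynomial bounds the number of minimal separators of all its members. -/
def Tame (𝒢 : ∀ n : ℕ, SimpleGraph (Fin n) → Prop) : Prop :=
  ∃ p : Polynomial ℕ, ∀ (n : ℕ) (G : SimpleGraph (Fin n)), 𝒢 n G → numMinSep G ≤ p.eval n

/-- A class of finite simple graphs is feral if for some real `c > 1` there are infinitely many
graphs `G` in the class with at least `c ^ |V(G)|` minimal separators. -/
def Feral (𝒢 : ∀ n : ℕ, SimpleGraph (Fin n) → Prop) : Prop :=
  ∃ c : ℝ, 1 < c ∧ ∀ N : ℕ, ∃ n : ℕ, N ≤ n ∧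
    ∃ G : SimpleGraph (Fin n), 𝒢 n G ∧ (c ^ n : ℝ) ≤ (numMinSep G : ℝ)

/-! ### Minors and induced minors via models -/

/-- An induced minor model of `H` in `G`. -/
def IsInducedMinorModel {V W : Type} (G : SimpleGraph V) (H : SimpleGraph W)
    (X : W → Set V) : Prop :=
  (∀ w, (X w).Nonempty) ∧
  (∀ w, (G.induce (X w)).Connected) ∧
  (Pairwise fun u w => Disjoint (X u) (X w)) ∧
  (∀ u w, H.Adj u w → ∃ a ∈ X u, ∃ b ∈ X w, G.Adj a b) ∧
  (∀ u w, u ≠ w → ¬ H.Adj u w → ∀ a ∈ X u, ∀ b ∈ X w, ¬ G.Adj a b)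

/-- `H` is an induced minor of `G`. -/
def InducedMinor {V W : Type} (H : SimpleGraph W) (G : SimpleGraph V) : Prop :=
  ∃ X : W → Set V, IsInducedMinorModel G H X

/-- A minor model of `H` in `G` (edges between branch sets of nonadjacent vertices allowed). -/
def IsMinorModel {V W : Type} (G : SimpleGraph V) (H : SimpleGraph W)
    (X : W → Set V) : Prop :=
  (∀ w, (X w).Nonempty) ∧
  (∀ w, (G.induce (X w)).Connected) ∧
  (Pairwise fun u w => Disjoint (X u) (X w)) ∧
  (∀ u w, H.Adj u w → ∃ a ∈ X u, ∃ b ∈ X w, G.Adj a b)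

/-- `H` is a minor of `G`. -/
def IsMinorOf {V W : Type} (H : SimpleGraph W) (G : SimpleGraph V) : Prop :=
  ∃ X : W → Set V, IsMinorModel G H X

/-! ### Subdivisions -/

/-- The graph obtained from `H` by subdividing the edge `uv`: the new vertex is `none`, it is
joined to `u` and `v`, the edge `uv` is removed and everything else is unchanged. -/
def subdivideEdge {W : Type} (H : SimpleGraph W) (u v : W) : SimpleGraph (Option W) :=
  SimpleGraph.fromRel fun x y =>
    (∃ a b : W, x = some a ∧ y = some b ∧ H.Adj a b ∧ ¬(a = u ∧ b = v) ∧ ¬(a = v ∧ b = u)) ∨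
    (x = none ∧ (y = some u ∨ y = some v))

/-- `Subdivision H H'` holds when `H'` is obtained from `H` by repeatedly subdividing edges. -/
inductive Subdivision : {A : Type} → SimpleGraph A → {B : Type} → SimpleGraph B → Prop where
  | refl {A : Type} (G : SimpleGraph A) : Subdivision G G
  | step {A : Type} {G : SimpleGraph A} {B : Type} {H : SimpleGraph B} {u v : B} :
      Subdivision G H → H.Adj u v → Subdivision G (subdivideEdge H u v)

/-- `G` contains an induced subdivision of `H`, i.e. `H` is an induced topological minor
of `G`: some subdivision of `H` is isomorphic to an induced subgraph of `G`. -/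
def ContainsInducedSubdivision {A V : Type} (H : SimpleGraph A) (G : SimpleGraph V) : Prop :=
  ∃ (B : Type) (H' : SimpleGraph B), Subdivision H H' ∧ Nonempty (H' ↪g G)

/-! ### Particular graphs -/

/-- `2P₂`: the disjoint union of two edges. -/
def twoP2 : SimpleGraph (Fin 4) :=
  SimpleGraph.fromRel fun v w => (v = 0 ∧ w = 1) ∨ (v = 2 ∧ w = 3)

/-- The diamond: `K₄` minus the edge `03`. -/
def diamond : SimpleGraph (Fin 4) :=
  SimpleGraph.fromRel fun v w => ¬(v = 0 ∧ w = 3) ∧ ¬(v = 3 ∧ w = 0)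

/-- The butterfly: two triangles `{0,1,2}` and `{0,3,4}` sharing the vertex `0`. -/
def butterfly : SimpleGraph (Fin 5) :=
  SimpleGraph.fromRel fun v w =>
    (v = 0 ∧ w = 1) ∨ (v = 0 ∧ w = 2) ∨ (v = 1 ∧ w = 2) ∨
    (v = 0 ∧ w = 3) ∨ (v = 0 ∧ w = 4) ∨ (v = 3 ∧ w = 4)

/-- The house: the `5`-cycle `0-1-2-3-4-0` together with the chord `03`. -/
def house : SimpleGraph (Fin 5) :=
  SimpleGraph.fromRel fun v w =>
    (v = 0 ∧ w = 1) ∨ (v = 1 ∧ w = 2) ∨ (v = 2 ∧ w = 3) ∨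
    (v = 3 ∧ w = 4) ∨ (v = 0 ∧ w = 4) ∨ (v = 0 ∧ w = 3)

/-- `K₃ + P₁`: a triangle together with an isolated vertex. -/
def k3PlusP1 : SimpleGraph (Fin 4) :=
  SimpleGraph.fromRel fun v w => (v = 0 ∧ w = 1) ∨ (v = 0 ∧ w = 2) ∨ (v = 1 ∧ w = 2)

/-- The (short) `k`-theta: vertices `a = inl 0`, `b = inl 1`, `aᵢ = inr (i, 0)`,
`bᵢ = inr (i, 1)`, with edges `a aᵢ`, `aᵢ bᵢ`, `bᵢ b`. -/
def thetaGraph (k : ℕ) : SimpleGraph (Fin 2 ⊕ Fin k × Fin 2) :=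
  SimpleGraph.fromRel fun v w =>
    (∃ i, v = Sum.inl 0 ∧ w = Sum.inr (i, 0)) ∨
    (∃ i, v = Sum.inl 1 ∧ w = Sum.inr (i, 1)) ∨
    (∃ i, v = Sum.inr (i, 0) ∧ w = Sum.inr (i, 1))

/-- The (short) `k`-prism: two `k`-cliques `{(i,0)}` and `{(i,1)}` with a perfect matching. -/
def prismGraph (k : ℕ) : SimpleGraph (Fin k × Fin 2) :=
  SimpleGraph.fromRel fun v w => (v.2 = w.2 ∧ v.1 ≠ w.1) ∨ (v.1 = w.1 ∧ v.2 ≠ w.2)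

/-- The `k`-skinny ladder: paths `p_i = (i,0)`, `q_i = (i,1)`, independent set `r_i = (i,2)`,
with edges `p_i p_{i+1}`, `q_i q_{i+1}`, `p_i r_i`, `q_i r_i`. -/
def skinnyLadder (k : ℕ) : SimpleGraph (Fin k × Fin 3) :=
  SimpleGraph.fromRel fun v w =>
    (v.2 = w.2 ∧ v.2 ≠ 2 ∧ w.1.val = v.1.val + 1) ∨
    (v.1 = w.1 ∧ v.2 ≠ 2 ∧ w.2 = 2)

/-- `gammaGraph p q r` is the graph `Γ` consisting of two vertices `a = inl 0` and `b = inl 1`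
joined by three internally disjoint paths with `p`, `q`, `r` internal vertices respectively
(so of lengths `p+1`, `q+1`, `r+1`); i.e. `Γ_{p+1, q+1, r+1}`. -/
def gammaGraph (p q r : ℕ) : SimpleGraph (Fin 2 ⊕ (Fin p ⊕ (Fin q ⊕ Fin r))) :=
  SimpleGraph.fromRel fun v w =>
    match v, w with
    | Sum.inl x, Sum.inl y => x = 0 ∧ y = 1 ∧ (p = 0 ∨ q = 0 ∨ r = 0)
    | Sum.inl x, Sum.inr (Sum.inl t) => (x = 0 ∧ t.val = 0) ∨ (x = 1 ∧ t.val = p - 1)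
    | Sum.inl x, Sum.inr (Sum.inr (Sum.inl t)) => (x = 0 ∧ t.val = 0) ∨ (x = 1 ∧ t.val = q - 1)
    | Sum.inl x, Sum.inr (Sum.inr (Sum.inr t)) => (x = 0 ∧ t.val = 0) ∨ (x = 1 ∧ t.val = r - 1)
    | Sum.inr (Sum.inl t), Sum.inr (Sum.inl s) => s.val = t.val + 1
    | Sum.inr (Sum.inr (Sum.inl t)), Sum.inr (Sum.inr (Sum.inl s)) => s.val = t.val + 1
    | Sum.inr (Sum.inr (Sum.inr t)), Sum.inr (Sum.inr (Sum.inr s)) => s.val = t.val + 1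
    | _, _ => False

/-- The long twin wheel on a cycle of length `n`: the cycle `0-1-⋯-(n-1)-0` on `Fin n`
together with a center adjacent exactly to the consecutive vertices `0`, `1`, `2`. -/
def longTwinWheel (n : ℕ) : SimpleGraph (Fin n ⊕ Unit) :=
  SimpleGraph.fromRel fun v w =>
    match v, w with
    | Sum.inl a, Sum.inl b => b.val = a.val + 1 ∨ (a.val = n - 1 ∧ b.val = 0)
    | Sum.inl a, Sum.inr _ => a.val = 0 ∨ a.val = 1 ∨ a.val = 2
    | _, _ => False

/-! ### Thin walks -/

/-- A thin walk in `H`: a walk whose vertices are pairwise distinct except that possibly the two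
endpoints coincide, and all of whose internal vertices have degree `2` in `H`. -/
def IsThinWalk {V : Type} (H : SimpleGraph V) {x y : V} (p : H.Walk x y) : Prop :=
  p.support.tail.Nodup ∧ p.support.dropLast.Nodup ∧
    ∀ v ∈ p.support.tail.dropLast, (H.neighborSet v).ncard = 2

/-! ### Creatures -/

/-- A `k`-creature in `G` on the pairwise disjoint nonempty vertex sets `A`, `B`, `X`, `Y`. -/
def IsCreature {V : Type} (G : SimpleGraph V) (k : ℕ) (A B X Y : Set V) : Prop :=
  A.Nonempty ∧ B.Nonempty ∧
  Disjoint A B ∧ Disjoint A X ∧ Disjoint A Y ∧ Disjoint B X ∧ Disjoint B Y ∧ Disjoint X Y ∧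
  (G.induce A).Connected ∧ (G.induce B).Connected ∧
  (∀ a ∈ A, ∀ b ∈ B, ¬ G.Adj a b) ∧
  (∀ a ∈ A, ∀ y ∈ Y, ¬ G.Adj a y) ∧
  (∀ b ∈ B, ∀ x ∈ X, ¬ G.Adj b x) ∧
  (∀ x ∈ X, ∃ a ∈ A, G.Adj x a) ∧
  (∀ y ∈ Y, ∃ b ∈ B, G.Adj y b) ∧
  ∃ (x : Fin k → V) (y : Fin k → V), Function.Injective x ∧ Function.Injective y ∧
    X = Set.range x ∧ Y = Set.range y ∧ ∀ i j, G.Adj (x i) (y j) ↔ i = j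

/-- `G` is `k`-creature-free. -/
def CreatureFree {V : Type} (G : SimpleGraph V) (k : ℕ) : Prop :=
  ¬ ∃ A B X Y : Set V, IsCreature G k A B X Y

/-! ### Distance to minor-closed classes, feedback vertex set number -/

/-- `cFam F G`: the least size of a vertex set `S` such that `G − S` has no minor isomorphic
to a member of the family `F`. -/
noncomputable def cFam {V : Type} (F : ∀ n : ℕ, SimpleGraph (Fin n) → Prop)
    (G : SimpleGraph V) : ℕ :=
  sInf {k | ∃ S : Set V, S.ncard = k ∧
    ∀ (n : ℕ) (H : SimpleGraph (Fin n)), F n H → ¬ IsMinorOf H (G.induce Sᶜ)}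

/-- The feedback vertex set number of `G`. -/
noncomputable def fvs {V : Type} (G : SimpleGraph V) : ℕ :=
  sInf {k | ∃ S : Set V, S.ncard = k ∧ (G.induce Sᶜ).IsAcyclic}

/-! ### Long unichords and long thetas -/

/-- `G` has a long unichord: an edge which is the unique chord of some cycle of length ≥ 5. -/
def HasLongUnichord {V : Type} (G : SimpleGraph V) : Prop :=
  ∃ (v : V) (c : G.Walk v v), c.IsCycle ∧ 5 ≤ c.length ∧
    ∃ a b : V, a ∈ c.support ∧ b ∈ c.support ∧ G.Adj a b ∧ s(a, b) ∉ c.edges ∧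
      ∀ x y : V, x ∈ c.support → y ∈ c.support → G.Adj x y → s(x, y) ∉ c.edges →
        s(x, y) = s(a, b)

/-- `G` is long-theta-free: no induced subgraph of `G` is a theta `Γ_{i,j,k}` with
`i, j, k ≥ 2` and at least one of `i, j, k` at least `3`. -/
def LongThetaFree {V : Type} (G : SimpleGraph V) : Prop :=
  ¬ ∃ i j k : ℕ, 2 ≤ i ∧ 2 ≤ j ∧ 2 ≤ k ∧ (3 ≤ i ∨ 3 ≤ j ∨ 3 ≤ k) ∧
    Nonempty (gammaGraph (i - 1) (j - 1) (k - 1) ↪g G)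

/-! ### Thetas laid out along a Hamiltonian path -/

/-- Adjacency of the theta on `{0, …, N - 1}` made of the path `0, 1, …, N - 1` together with the
edges `0 j` and `i (N - 1)`. -/
def ThetaAdj (N i j x y : ℕ) : Prop :=
  x + 1 = y ∨ y + 1 = x ∨ (x = 0 ∧ y = j) ∨ (y = 0 ∧ x = j) ∨
    (x = i ∧ y + 1 = N) ∨ (y = i ∧ x + 1 = N)

/-- The theta described by `ThetaAdj N i j` is a subdivision of the house. -/
def IsHouseTheta (N i j : ℕ) : Prop :=
  ∃ (B : Type) (H : SimpleGraph B) (f : B → ℕ), Subdivision house H ∧ Function.Injective f ∧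
    (∀ b, f b < N) ∧ (∀ z < N, ∃ b, f b = z) ∧
    ∀ b c, H.Adj b c ↔ ThetaAdj N i j (f b) (f c)

theorem subdivideEdge_some_some {W : Type} (H : SimpleGraph W) (u v a b : W) :
    (subdivideEdge H u v).Adj (some a) (some b) ↔
      H.Adj a b ∧ ¬(a = u ∧ b = v) ∧ ¬(a = v ∧ b = u) := by
  simp only [subdivideEdge, SimpleGraph.fromRel_adj]
  constructor
  · rintro ⟨-, h | h⟩
    · rcases h with ⟨a', b', h1, h2, h3⟩ | h
      · cases h1; cases h2; exact h3
      · simp at h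
    · rcases h with ⟨a', b', h1, h2, h3, h4, h5⟩ | h
      · cases h1; cases h2; exact ⟨h3.symm, fun h => h5 ⟨h.2, h.1⟩, fun h => h4 ⟨h.2, h.1⟩⟩
      · simp at h
  · rintro ⟨h1, h2⟩
    exact ⟨fun h => h1.ne (Option.some.inj h), Or.inl (Or.inl ⟨a, b, rfl, rfl, h1, h2⟩)⟩

theorem subdivideEdge_none_some {W : Type} (H : SimpleGraph W) (u v a : W) :
    (subdivideEdge H u v).Adj none (some a) ↔ a = u ∨ a = v := by
  simp [subdivideEdge, SimpleGraph.fromRel_adj]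

/-- Subdividing the edge between positions `r` and `s`, where the old vertices move along `φ` and
the new vertex takes position `w`. -/
theorem IsHouseTheta.subdivide {N i j N' i' j' r s w : ℕ} (φ : ℕ → ℕ) (h : IsHouseTheta N i j)
    (hr : r < N) (hs : s < N) (hrs : ThetaAdj N i j r s)
    (hφ : ∀ x < N, φ x < N' ∧ φ x ≠ w) (hinj : ∀ x < N, ∀ y < N, φ x = φ y → x = y)
    (hw : w < N') (hsurj : ∀ z < N', z ≠ w → ∃ x < N, φ x = z)
    (hold : ∀ x < N, ∀ y < N, ThetaAdj N' i' j' (φ x) (φ y) ↔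
      ThetaAdj N i j x y ∧ ¬(x = r ∧ y = s) ∧ ¬(x = s ∧ y = r))
    (hnew : ∀ x < N, ThetaAdj N' i' j' w (φ x) ↔ x = r ∨ x = s)
    (hloop : ¬ ThetaAdj N' i' j' w w) : IsHouseTheta N' i' j' := by
  obtain ⟨B, H, f, hsub, finj, flt, fsurj, fadj⟩ := h
  obtain ⟨u, rfl⟩ := fsurj r hr
  obtain ⟨v, rfl⟩ := fsurj s hs
  have hsymm : ∀ x y, ThetaAdj N' i' j' x y ↔ ThetaAdj N' i' j' y x := by
    intro x y; unfold ThetaAdj; tauto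
  refine ⟨Option B, subdivideEdge H u v, fun b => b.elim w (fun b => φ (f b)),
    hsub.step ((fadj u v).2 hrs), ?_, ?_, ?_, ?_⟩
  · rintro (_ | b) (_ | c) hbc
    · rfl
    · exact absurd hbc.symm (hφ _ (flt c)).2
    · exact absurd hbc (hφ _ (flt b)).2
    · exact congrArg some (finj (hinj _ (flt b) _ (flt c) hbc))
  · rintro (_ | b)
    · exact hw
    · exact (hφ _ (flt b)).1
  · intro z hz
    by_cases hzw : z = w
    · exact ⟨none, hzw.symm⟩
    · obtain ⟨x, hx, rfl⟩ := hsurj z hz hzw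
      obtain ⟨b, rfl⟩ := fsurj x hx
      exact ⟨some b, rfl⟩
  · rintro (_ | b) (_ | c)
    · simpa using hloop
    · rw [subdivideEdge_none_some]
      simp [hnew _ (flt c), finj.eq_iff]
    · rw [SimpleGraph.adj_comm, subdivideEdge_none_some, hsymm]
      simp [hnew _ (flt b), finj.eq_iff]
    · rw [subdivideEdge_some_some]
      simp [hold _ (flt b) _ (flt c), finj.eq_iff, fadj]

theorem IsHouseTheta.lengthen_last {N i j : ℕ} (h : IsHouseTheta N i j) (hij : i < j)
    (hj : j + 2 ≤ N) : IsHouseTheta (N + 1) i j := by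
  refine h.subdivide (r := i) (s := N - 1) (w := N) (fun x => x)
    (by omega) (by omega) ?_ ?_ ?_ ?_ ?_ ?_ ?_ ?_
  all_goals try unfold ThetaAdj
  · omega
  · intros; omega
  · intros; omega
  · omega
  · intro z _ _; exact ⟨z, by omega, rfl⟩
  · intros; omega
  · intros; omega
  · omega

theorem IsHouseTheta.lengthen_first {N i j : ℕ} (h : IsHouseTheta N i j) (hij : i < j)
    (hj : j + 2 ≤ N) (hs : i + 2 ≤ j ∨ 2 ≤ i) : IsHouseTheta (N + 1) (i + 1) (j + 1) := by
  refine h.subdivide (r := 0) (s := j) (w := 0) (· + 1)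
    (by omega) (by omega) ?_ ?_ ?_ ?_ ?_ ?_ ?_ ?_
  all_goals try unfold ThetaAdj
  · omega
  · intros; omega
  · intros; omega
  · omega
  · intro z _ _; exact ⟨z - 1, by omega, by omega⟩
  · intros; omega
  · intros; omega
  · omega

theorem IsHouseTheta.lengthen_middle {N i j : ℕ} (h : IsHouseTheta N i j) (hij : i < j)
    (hj : j + 2 ≤ N) (hs : i + 2 ≤ j ∨ 2 ≤ i) : IsHouseTheta (N + 1) i (j + 1) := by
  obtain ⟨φ, hφ⟩ : ∃ φ : ℕ → ℕ, ∀ x, x ≤ i ∧ φ x = x ∨ i < x ∧ φ x = x + 1 :=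
    ⟨fun x => if x ≤ i then x else x + 1, fun x => by dsimp only; grind⟩
  refine h.subdivide (r := i) (s := i + 1) (w := i + 1) φ
    (by omega) (by omega) ?_ ?_ ?_ ?_ ?_ ?_ ?_ ?_
  all_goals try unfold ThetaAdj
  · omega
  · intro x _; have := hφ x; omega
  · intro x _ y _; have := hφ x; have := hφ y; omega
  · omega
  · intro z _ _
    by_cases hz : z ≤ i
    · exact ⟨z, by omega, by have := hφ z; omega⟩
    · exact ⟨z - 1, by omega, by have := hφ (z - 1); omega⟩
  · intro x _ y _
    rcases hφ x with ⟨hx, e⟩ | ⟨hx, e⟩ <;> rcases hφ y with ⟨hy, e'⟩ | ⟨hy, e'⟩ <;>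
      rw [e, e'] <;> clear e e' <;> omega
  · intro x _
    rcases hφ x with ⟨hx, e⟩ | ⟨hx, e⟩ <;> rw [e] <;> clear e <;> omega
  · omega

theorem isHouseTheta_five_zero_three : IsHouseTheta 5 0 3 := by
  refine ⟨Fin 5, house, fun b => b.val, .refl _, Fin.val_injective, fun b => b.isLt,
    fun z hz => ⟨⟨z, hz⟩, rfl⟩, ?_⟩
  unfold house ThetaAdj
  simp only [SimpleGraph.fromRel_adj]
  decide

theorem isHouseTheta_five_two_three : IsHouseTheta 5 2 3 := by
  refine ⟨Fin 5, house, fun b => (![3, 0, 1, 2, 4] : Fin 5 → ℕ) b, .refl _, ?_, ?_, ?_, ?_⟩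
  · unfold Function.Injective; decide
  · decide
  · decide
  · unfold house ThetaAdj
    simp only [SimpleGraph.fromRel_adj]
    decide

/-- A theta with paths of lengths `a + 1`, `b + 1` and `c + 2`, one of the first two having length
at least `3`, is a subdivision of the house. -/
theorem isHouseTheta_of_le {a b c : ℕ} (hab : 2 ≤ a ∨ 2 ≤ b) :
    IsHouseTheta (a + b + c + 3) a (a + b + 1) := by
  induction c with
  | succ c ih => exact ih.lengthen_last (by omega) (by omega)
  | zero =>
    rcases hab with ha | hb
    · induction b with
      | succ b ih => exact ih.lengthen_middle (by omega) (by omega) (by omega)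
      | zero =>
        induction a, ha using Nat.le_induction with
        | base => exact isHouseTheta_five_two_three
        | succ a ha ih => exact ih.lengthen_first (by omega) (by omega) (by omega)
    · induction a with
      | succ a ih =>
        have := ih.lengthen_first (by omega) (by omega) (by omega)
        convert this using 1 <;> omega
      | zero =>
        induction b, hb using Nat.le_induction with
        | base => exact isHouseTheta_five_zero_three
        | succ b hb ih =>
          have := ih.lengthen_middle (by omega) (by omega) (by omega)
          convert this using 1 <;> omega

theorem containsInducedSubdivision_house_of_theta {V : Type} {G : SimpleGraph V} {N i j : ℕ}
    (hT : IsHouseTheta N i j) (p : ℕ → V) (hinj : ∀ x < N, ∀ y < N, p x = p y → x = y)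
    (hadj : ∀ x < N, ∀ y < N, G.Adj (p x) (p y) ↔ ThetaAdj N i j x y) :
    ContainsInducedSubdivision house G := by
  obtain ⟨B, H, f, hsub, finj, flt, -, fadj⟩ := hT
  refine ⟨B, H, hsub, ⟨⟨⟨p ∘ f, fun b c h => finj (hinj _ (flt b) _ (flt c) h)⟩, ?_⟩⟩⟩
  intro b c
  exact (hadj _ (flt b) _ (flt c)).trans (fadj b c).symm

/-! ### Induced paths and holes -/

section Holes

variable {V : Type} {G : SimpleGraph V}

/-- `p 0, …, p (m - 1)` is an induced path. -/
structure IsPathSeq (G : SimpleGraph V) (m : ℕ) (p : ℕ → V) : Prop where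
  inj : ∀ x < m, ∀ y < m, p x = p y → x = y
  adj : ∀ x < m, ∀ y < m, G.Adj (p x) (p y) ↔ x + 1 = y ∨ y + 1 = x

/-- Adjacency of the cycle `0, 1, …, n - 1`. -/
def CycAdj (n x y : ℕ) : Prop :=
  x + 1 = y ∨ y + 1 = x ∨ (x = 0 ∧ y + 1 = n) ∨ (y = 0 ∧ x + 1 = n)

/-- `g 0, …, g (n - 1)` is an induced cycle with vertex set `C`. -/
structure IsHoleSeq (G : SimpleGraph V) (n : ℕ) (g : ℕ → V) (C : Set V) : Prop where
  inj : ∀ x < n, ∀ y < n, g x = g y → x = y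
  adj : ∀ x < n, ∀ y < n, G.Adj (g x) (g y) ↔ CycAdj n x y
  mem : ∀ c, c ∈ C ↔ ∃ x < n, g x = c

/-- `C` is the vertex set of an induced cycle of length `n`. -/
def IsHole (G : SimpleGraph V) (n : ℕ) (C : Set V) : Prop :=
  ∃ g, IsHoleSeq G n g C

theorem IsHole.exists_seq {n : ℕ} {C : Set V} (hC : IsHole G n C) {z : V} (hz : z ∈ C) :
    ∃ g, IsHoleSeq G n g C ∧ g 0 = z := by
  obtain ⟨g, hg⟩ := hC
  obtain ⟨k, hk, rfl⟩ := (hg.mem z).1 hz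
  obtain ⟨φ, hφ⟩ : ∃ φ : ℕ → ℕ, ∀ x, x + k < n ∧ φ x = x + k ∨ n ≤ x + k ∧ φ x = x + k - n :=
    ⟨fun x => if x + k < n then x + k else x + k - n, fun x => by grind⟩
  have hlt : ∀ x < n, φ x < n := fun x hx => by have := hφ x; omega
  refine ⟨fun x => g (φ x), ⟨?_, ?_, ?_⟩, ?_⟩
  · intro x hx y hy hxy
    have := hg.inj _ (hlt x hx) _ (hlt y hy) hxy
    have := hφ x
    have := hφ y
    omega
  · intro x hx y hy
    rw [hg.adj _ (hlt x hx) _ (hlt y hy)]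
    unfold CycAdj
    rcases hφ x with ⟨h1, e⟩ | ⟨h1, e⟩ <;> rcases hφ y with ⟨h2, e'⟩ | ⟨h2, e'⟩ <;>
      rw [e, e'] <;> clear e e' <;> omega
  · intro c
    rw [hg.mem]
    constructor
    · rintro ⟨y, hy, rfl⟩
      by_cases hky : k ≤ y
      · exact ⟨y - k, by omega, by congr 1; have := hφ (y - k); omega⟩
      · exact ⟨y + n - k, by omega, by congr 1; have := hφ (y + n - k); omega⟩
    · rintro ⟨x, hx, rfl⟩
      exact ⟨φ x, hlt x hx, rfl⟩
  · have := hφ 0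
    exact congrArg g (by omega)

theorem isPathSeq_one (v : V) : IsPathSeq G 1 (fun _ => v) :=
  ⟨fun x hx y hy _ => by omega, fun x hx y hy => by
    simp only [SimpleGraph.irrefl, false_iff]; omega⟩

theorem IsPathSeq.reverse {m : ℕ} {p : ℕ → V} (hp : IsPathSeq G m p) :
    IsPathSeq G m (fun x => p (m - 1 - x)) :=
  ⟨fun x hx y hy h => by have := hp.inj _ (by omega) _ (by omega) h; omega,
    fun x hx y hy => by rw [hp.adj _ (by omega) _ (by omega)]; omega⟩

theorem IsPathSeq.segment {m : ℕ} {p : ℕ → V} (hp : IsPathSeq G m p) (k l : ℕ) (h : k + l ≤ m) :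
    IsPathSeq G l (fun x => p (x + k)) :=
  ⟨fun x hx y hy h => by have := hp.inj _ (by omega) _ (by omega) h; omega,
    fun x hx y hy => by rw [hp.adj _ (by omega) _ (by omega)]; omega⟩

/-- A hole with an induced path attached at two of its vertices contains a subdivided house. -/
theorem IsHole.house_of_ear {n m : ℕ} {C : Set V} {x y : V} {p : ℕ → V} (hC : IsHole G n C)
    (hx : x ∈ C) (hy : y ∈ C) (hxy : x ≠ y) (hn : 5 ≤ n ∨ 4 ≤ n ∧ G.Adj x y)
    (hp : IsPathSeq G m p) (hm : 1 ≤ m) (hpC : ∀ i < m, p i ∉ C)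
    (hatt : ∀ i < m, ∀ c ∈ C, G.Adj (p i) c ↔ (i = 0 ∧ c = x) ∨ (i + 1 = m ∧ c = y)) :
    ContainsInducedSubdivision house G := by
  obtain ⟨g, hg, rfl⟩ := hC.exists_seq hx
  obtain ⟨i, hi, rfl⟩ := (hg.mem y).1 hy
  have hi0 : i ≠ 0 := by rintro rfl; exact hxy rfl
  have hab : 2 ≤ n - 1 - i ∨ 2 ≤ i - 1 := by
    rcases hn with hn | ⟨hn, hadj⟩
    · omega
    · rw [hg.adj _ (by omega) _ hi] at hadj
      unfold CycAdj at hadj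
      omega
  have hT : IsHouseTheta (n + m) (n - 1 - i) (n - 1) := by
    have := isHouseTheta_of_le (c := m - 1) hab
    convert this using 1 <;> omega
  have hgC : ∀ z < n, g z ∈ C := fun z hz => (hg.mem _).2 ⟨z, hz, rfl⟩
  have hmix : ∀ z < n, ∀ w < m, G.Adj (p w) (g (n - 1 - z)) ↔
      (w = 0 ∧ z = n - 1) ∨ (w + 1 = m ∧ z = n - 1 - i) := by
    intro z hz w hw
    rw [hatt w hw _ (hgC _ (by omega))]
    have h1 : g (n - 1 - z) = g 0 ↔ z = n - 1 :=
      ⟨fun h => by have := hg.inj _ (by omega) _ (by omega) h; omega, fun h => by congr 1; omega⟩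
    have h2 : g (n - 1 - z) = g i ↔ z = n - 1 - i :=
      ⟨fun h => by have := hg.inj _ (by omega) _ (by omega) h; omega, fun h => by congr 1; omega⟩
    rw [h1, h2]
  refine containsInducedSubdivision_house_of_theta hT
    (fun z => if z < n then g (n - 1 - z) else p (z - n)) ?_ ?_
  · intro z hz w hw h
    split_ifs at h with h1 h2 h2
    · have := hg.inj _ (by omega) _ (by omega) h
      omega
    · exact absurd (h ▸ hgC _ (by omega)) (hpC (w - n) (by omega))
    · exact absurd (h ▸ hgC _ (by omega)) (hpC (z - n) (by omega))
    · have := hp.inj _ (by omega) _ (by omega) h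
      omega
  · intro z hz w hw
    split_ifs with h1 h2 h2
    · rw [hg.adj _ (by omega) _ (by omega)]
      unfold CycAdj ThetaAdj
      omega
    · rw [SimpleGraph.adj_comm, hmix z h1 (w - n) (by omega)]
      unfold ThetaAdj
      omega
    · rw [hmix w h2 (z - n) (by omega)]
      unfold ThetaAdj
      omega
    · rw [hp.adj _ (by omega) _ (by omega)]
      unfold ThetaAdj
      omega

end Holes

section Attachments

variable {V : Type} {G : SimpleGraph V}

/-- A vertex `v` off a hole, whose extreme neighbours on it are `g s` and `g t`, closes up the
complementary arc to a hole. -/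
theorem IsHoleSeq.isHole_outer {n s t : ℕ} {C : Set V} {v : V} {g : ℕ → V}
    (hg : IsHoleSeq G n g C) (hv : v ∉ C) (hs : 0 < s) (hst : s + 1 < t) (ht : t < n)
    (hvs : G.Adj v (g s)) (hvt : G.Adj v (g t))
    (hmin : ∀ i < n, G.Adj v (g i) → s ≤ i ∧ i ≤ t) :
    IsHole G (n - t + s + 2) {c | c = v ∨ ∃ i < n, (i ≤ s ∨ t ≤ i) ∧ g i = c} := by
  obtain ⟨φ, hφ⟩ : ∃ φ : ℕ → ℕ, ∀ x, t + x < n + 1 ∧ φ x = t + x - 1 ∨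
      n + 1 ≤ t + x ∧ φ x = t + x - 1 - n :=
    ⟨fun x => if t + x < n + 1 then t + x - 1 else t + x - 1 - n, fun x => by grind⟩
  have hlt : ∀ x < n - t + s + 2, 0 < x → φ x < n ∧ (φ x ≤ s ∨ t ≤ φ x) :=
    fun x hx hx0 => by have := hφ x; omega
  have hgv : ∀ i < n, g i ≠ v := fun i hi h => hv ((hg.mem v).2 ⟨i, hi, h⟩)
  have hadjv : ∀ x < n - t + s + 2, 0 < x →
      (G.Adj v (g (φ x)) ↔ x = 1 ∨ x = n - t + s + 1) := by
    intro x hx hx0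
    have h1 := hφ x
    have h2 := hlt x hx hx0
    constructor
    · intro h
      have := hmin _ h2.1 h
      omega
    · rintro (h | h)
      · rwa [show φ x = t by omega]
      · rwa [show φ x = s by omega]
  refine ⟨fun x => if x = 0 then v else g (φ x), ⟨?_, ?_, ?_⟩⟩
  · intro x hx y hy hxy
    split_ifs at hxy with h1 h2 h2
    · omega
    · exact absurd hxy.symm (hgv _ (hlt y hy (by omega)).1)
    · exact absurd hxy (hgv _ (hlt x hx (by omega)).1)
    · have := hg.inj _ (hlt x hx (by omega)).1 _ (hlt y hy (by omega)).1 hxy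
      have := hφ x
      have := hφ y
      omega
  · intro x hx y hy
    split_ifs with h1 h2 h2
    · simp only [SimpleGraph.irrefl, false_iff]
      unfold CycAdj
      omega
    · rw [hadjv y hy (by omega)]
      unfold CycAdj
      omega
    · rw [SimpleGraph.adj_comm, hadjv x hx (by omega)]
      unfold CycAdj
      omega
    · rw [hg.adj _ (hlt x hx (by omega)).1 _ (hlt y hy (by omega)).1]
      unfold CycAdj
      rcases hφ x with ⟨h3, e⟩ | ⟨h3, e⟩ <;> rcases hφ y with ⟨h4, e'⟩ | ⟨h4, e'⟩ <;>
        rw [e, e'] <;> clear e e' <;> omega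
  · intro c
    constructor
    · rintro (rfl | ⟨i, hi, his, rfl⟩)
      · exact ⟨0, by omega, rfl⟩
      · by_cases h : t ≤ i
        · have := hφ (i - t + 1)
          exact ⟨i - t + 1, by omega, by rw [if_neg (by omega)]; congr 1; omega⟩
        · have := hφ (i + n - t + 1)
          exact ⟨i + n - t + 1, by omega, by rw [if_neg (by omega)]; congr 1; omega⟩
    · rintro ⟨x, hx, rfl⟩
      split_ifs with h
      · exact Or.inl rfl
      · have := hlt x hx (by omega)
        exact Or.inr ⟨φ x, this.1, this.2, rfl⟩

/-- `v` attaches to the hole `C` exactly at `x`, or exactly at `x` and its two neighbours. -/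
def AttachesAt (G : SimpleGraph V) (C : Set V) (v x : V) : Prop :=
  (∀ c ∈ C, G.Adj v c ↔ c = x) ∨ ∀ c ∈ C, G.Adj v c ↔ c = x ∨ G.Adj x c

/-- In a graph without a subdivided house, a vertex off a hole of length at least `5` that is not
complete to it has no neighbour on it, or one, or three consecutive ones. -/
theorem IsHole.exists_attachesAt (hG : ¬ ContainsInducedSubdivision house G) {n : ℕ} {C : Set V}
    {v z w : V} (hC : IsHole G n C) (hn : 5 ≤ n) (hv : v ∉ C) (hz : z ∈ C) (hvz : ¬ G.Adj v z)
    (hw : w ∈ C) (hvw : G.Adj v w) : ∃ x ∈ C, AttachesAt G C v x := by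
  classical
  obtain ⟨g, hg, rfl⟩ := hC.exists_seq hz
  have hgC : ∀ i < n, g i ∈ C := fun i hi => (hg.mem _).2 ⟨i, hi, rfl⟩
  have hgv : ∀ i < n, g i ≠ v := fun i hi h => hv ((hg.mem v).2 ⟨i, hi, h⟩)
  have hex : ∃ i, i < n ∧ G.Adj v (g i) := by
    obtain ⟨i, hi, rfl⟩ := (hg.mem w).1 hw
    exact ⟨i, hi, hvw⟩
  obtain ⟨s, ⟨hsn, hvs⟩, hsmin⟩ : ∃ s, (s < n ∧ G.Adj v (g s)) ∧
      ∀ i < n, G.Adj v (g i) → s ≤ i :=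
    ⟨Nat.find hex, Nat.find_spec hex, fun i hi h => Nat.find_min' hex ⟨hi, h⟩⟩
  obtain ⟨t, ⟨htn, hvt⟩, htmax⟩ : ∃ t, (t < n ∧ G.Adj v (g t)) ∧
      ∀ i < n, G.Adj v (g i) → i ≤ t :=
    ⟨Nat.findGreatest (fun i => i < n ∧ G.Adj v (g i)) n,
      Nat.findGreatest_spec (P := fun i => i < n ∧ G.Adj v (g i)) hsn.le ⟨hsn, hvs⟩,
      fun i hi h => Nat.le_findGreatest hi.le ⟨hi, h⟩⟩
  have hs0 : 0 < s := by
    rcases Nat.eq_zero_or_pos s with rfl | h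
    · exact absurd hvs hvz
    · exact h
  rcases (hsmin t htn hvt).eq_or_lt with rfl | hst
  · refine ⟨g s, hgC s hsn, Or.inl fun c hc => ⟨fun h => ?_, by rintro rfl; exact hvs⟩⟩
    obtain ⟨i, hi, rfl⟩ := (hg.mem c).1 hc
    rw [le_antisymm (htmax i hi h) (hsmin i hi h)]
  have hex' : ∃ i, s < i ∧ i < n ∧ G.Adj v (g i) := ⟨t, hst, htn, hvt⟩
  obtain ⟨r, ⟨hsr, hrn, hvr⟩, hrmin⟩ : ∃ r, (s < r ∧ r < n ∧ G.Adj v (g r)) ∧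
      ∀ i < n, s < i → G.Adj v (g i) → r ≤ i :=
    ⟨Nat.find hex', Nat.find_spec hex', fun i hi h h' => Nat.find_min' hex' ⟨h, hi, h'⟩⟩
  rcases (htmax r hrn hvr).eq_or_lt with rfl | hrt
  · refine absurd (hC.house_of_ear (hgC s hsn) (hgC r hrn) ?_ (Or.inl hn) (isPathSeq_one v) le_rfl
      (fun _ _ => hv) ?_) hG
    · intro h
      have := hg.inj _ hsn _ hrn h
      omega
    · intro i hi c hc
      obtain ⟨k, hk, rfl⟩ := (hg.mem c).1 hc
      constructor
      · intro h
        have h1 := hsmin k hk h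
        have h2 := hrmin k hk
        have h3 := htmax k hk h
        rcases h1.eq_or_lt with rfl | h1
        · exact Or.inl ⟨by omega, rfl⟩
        · rw [le_antisymm h3 (h2 h1 h)]
          exact Or.inr ⟨by omega, rfl⟩
      · rintro (⟨-, h⟩ | ⟨-, h⟩) <;> rw [h]
        · exact hvs
        · exact hvr
  have houter := hg.isHole_outer hv hs0 (by omega) htn hvs hvt
    fun i hi h => ⟨hsmin i hi h, htmax i hi h⟩
  by_cases hrt1 : r + 1 = t
  · by_cases hsr1 : s + 1 = r
    · refine ⟨g r, hgC r hrn, Or.inr fun c hc => ?_⟩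
      obtain ⟨k, hk, rfl⟩ := (hg.mem c).1 hc
      have heq : g k = g r ↔ k = r := ⟨hg.inj k hk r hrn, by rintro rfl; rfl⟩
      rw [hg.adj r hrn k hk, heq]
      unfold CycAdj
      constructor
      · intro h
        have h1 := hsmin k hk h
        have h3 := htmax k hk h
        omega
      · intro h
        have : k = s ∨ k = r ∨ k = t := by omega
        rcases this with rfl | rfl | rfl <;> assumption
    · refine absurd (houter.house_of_ear (x := g t) (y := v) (p := fun _ => g r)
        (Or.inr ⟨t, htn, Or.inr le_rfl, rfl⟩) (Or.inl rfl) (hgv t htn)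
        (Or.inr ⟨by omega, hvt.symm⟩) (isPathSeq_one _) le_rfl ?_ ?_) hG
      · rintro - - (h | ⟨i, hi, his, h⟩)
        · exact hgv r hrn h
        · have := hg.inj _ hi _ hrn h
          omega
      · rintro i hi c (rfl | ⟨k, hk, hks, rfl⟩)
        · exact ⟨fun _ => Or.inr ⟨by omega, rfl⟩, fun _ => hvr.symm⟩
        · have heq : g k = g t ↔ k = t := ⟨hg.inj k hk t htn, by rintro rfl; rfl⟩
          simp only [hgv k hk, and_false, or_false]
          rw [hg.adj r hrn k hk, heq]
          unfold CycAdj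
          omega
  · refine absurd (houter.house_of_ear (x := g s) (y := v) (p := fun i => g (i + s + 1))
        (m := r - s) (Or.inr ⟨s, hsn, Or.inl le_rfl, rfl⟩) (Or.inl rfl) (hgv s hsn)
        (Or.inr ⟨by omega, hvs.symm⟩) ⟨?_, ?_⟩ (by omega) ?_ ?_) hG
    · intro x hx y hy h
      have := hg.inj _ (by omega) _ (by omega) h
      omega
    · intro x hx y hy
      rw [hg.adj _ (by omega) _ (by omega)]
      unfold CycAdj
      omega
    · rintro i hi (h | ⟨k, hk, hks, h⟩)
      · exact hgv _ (by omega) h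
      · have := hg.inj _ hk _ (by omega) h
        omega
    · rintro i hi c (rfl | ⟨k, hk, hks, rfl⟩)
      · constructor
        · intro h
          have := hrmin (i + s + 1) (by omega) (by omega) h.symm
          exact Or.inr ⟨by omega, rfl⟩
        · rintro (⟨-, h⟩ | ⟨h, -⟩)
          · exact absurd h.symm (hgv s hsn)
          · rw [show i + s + 1 = r by omega]
            exact hvr.symm
      · have heq : g k = g s ↔ k = s := ⟨hg.inj k hk s hsn, by rintro rfl; rfl⟩
        simp only [hgv k hk, and_false, or_false]
        rw [hg.adj _ (by omega) k hk, heq]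
        unfold CycAdj
        omega

end Attachments

section Detours

variable {V : Type} {G : SimpleGraph V}

/-- A vertex of a hole may be exchanged for a twin of it. -/
theorem IsHole.replace {n : ℕ} {C : Set V} {v x : V} (hC : IsHole G n C) (hn : 3 ≤ n) (hv : v ∉ C)
    (hx : x ∈ C) (hvx : ∀ c ∈ C, G.Adj v c ↔ c = x ∨ G.Adj x c) :
    IsHole G n {c | c = v ∨ c ∈ C ∧ c ≠ x} := by
  obtain ⟨g, hg, rfl⟩ := hC.exists_seq hx
  have hgC : ∀ i < n, g i ∈ C := fun i hi => (hg.mem _).2 ⟨i, hi, rfl⟩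
  have hgv : ∀ i < n, g i ≠ v := fun i hi h => hv (h ▸ hgC i hi)
  have hg0 : ∀ i < n, i ≠ 0 → g i ≠ g 0 := fun i hi h h' => h (hg.inj i hi 0 (by omega) h')
  have hadj : ∀ i < n, i ≠ 0 → (G.Adj v (g i) ↔ CycAdj n 0 i) := by
    intro i hi hi0
    rw [hvx _ (hgC i hi), hg.adj 0 (by omega) i hi]
    simp [hg0 i hi hi0]
  refine ⟨fun i => if i = 0 then v else g i, ⟨?_, ?_, ?_⟩⟩
  · intro i hi j hj h
    split_ifs at h with h1 h2 h2
    · omega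
    · exact absurd h.symm (hgv j hj)
    · exact absurd h (hgv i hi)
    · exact hg.inj i hi j hj h
  · intro i hi j hj
    split_ifs with h1 h2 h2
    · simp only [SimpleGraph.irrefl, false_iff]
      unfold CycAdj
      omega
    · rw [hadj j hj h2, h1]
    · rw [SimpleGraph.adj_comm, hadj i hi h1, h2]
      unfold CycAdj
      omega
    · exact hg.adj i hi j hj
  · intro c
    constructor
    · rintro (rfl | ⟨hc, hcx⟩)
      · exact ⟨0, by omega, rfl⟩
      · obtain ⟨i, hi, rfl⟩ := (hg.mem c).1 hc
        exact ⟨i, hi, if_neg (by rintro rfl; exact hcx rfl)⟩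
    · rintro ⟨i, hi, rfl⟩
      split_ifs with h
      · exact Or.inl rfl
      · exact Or.inr ⟨hgC i hi, hg0 i hi h⟩

/-- A hole with an induced path attached at a single vertex at one end, and at a vertex or its
closed neighbourhood at the other end, contains a subdivided house. -/
theorem IsHole.house_of_single_attachesAt {n m : ℕ} {C : Set V} {x y : V} {p : ℕ → V}
    (hC : IsHole G n C) (hn : 5 ≤ n) (hx : x ∈ C) (hy : y ∈ C) (hxy : x ≠ y)
    (hp : IsPathSeq G m p) (hm : 2 ≤ m) (hpC : ∀ i < m, p i ∉ C)
    (hint : ∀ i, 0 < i → i + 1 < m → ∀ c ∈ C, ¬ G.Adj (p i) c)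
    (hfirst : ∀ c ∈ C, G.Adj (p 0) c ↔ c = x) (hlast : AttachesAt G C (p (m - 1)) y) :
    ContainsInducedSubdivision house G := by
  rcases hlast with hlast | hlast
  · refine hC.house_of_ear hx hy hxy (Or.inl hn) hp (by omega) hpC fun i hi c hc => ?_
    rcases Nat.eq_zero_or_pos i with rfl | hi0
    · rw [hfirst c hc]
      have : ¬ 0 + 1 = m := by omega
      simp [this]
    · by_cases him : i + 1 < m
      · have := hint i hi0 him c hc
        simp only [this, false_iff]
        omega
      · obtain rfl : i = m - 1 := by omega
        rw [hlast c hc]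
        have : ¬ m - 1 = 0 := by omega
        simp [this, show m - 1 + 1 = m by omega]
  · refine (hC.replace (by omega) (hpC (m - 1) (by omega)) hy hlast).house_of_ear (m := m - 1)
      (p := p) (x := x) (y := p (m - 1)) (Or.inr ⟨hx, hxy⟩) (Or.inl rfl)
      (fun h => hpC (m - 1) (by omega) (h ▸ hx)) (Or.inl hn)
      ⟨fun i hi j hj => hp.inj i (by omega) j (by omega),
        fun i hi j hj => hp.adj i (by omega) j (by omega)⟩ (by omega) ?_ ?_
    · rintro i hi (h | ⟨h, -⟩)
      · have := hp.inj _ (by omega) _ (by omega) h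
        omega
      · exact hpC i (by omega) h
    · rintro i hi c (rfl | ⟨hc, hcy⟩)
      · have hne : p (m - 1) ≠ x := fun h => hpC (m - 1) (by omega) (h ▸ hx)
        rw [hp.adj _ (by omega) _ (by omega)]
        simp only [hne, and_false, false_or, and_true]
        omega
      · have hne : c ≠ p (m - 1) := fun h => hpC (m - 1) (by omega) (h ▸ hc)
        simp only [hne, and_false, or_false]
        rcases Nat.eq_zero_or_pos i with rfl | hi0
        · rw [hfirst c hc]
          simp
        · have := hint i hi0 (by omega) c hc
          simp only [this, false_iff]
          omega

/-- A hole with two adjacent vertices attached to it at nonadjacent centres contains a subdivided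
house. -/
theorem IsHole.house_of_adj_of_twins {n : ℕ} {C : Set V} {x y v w : V} (hC : IsHole G n C)
    (hn : 5 ≤ n) (hx : x ∈ C) (hy : y ∈ C) (hxy : x ≠ y) (hnadj : ¬ G.Adj x y)
    (hv : v ∉ C) (hw : w ∉ C) (hvw : G.Adj v w)
    (hvx : ∀ c ∈ C, G.Adj v c ↔ c = x ∨ G.Adj x c)
    (hwy : ∀ c ∈ C, G.Adj w c ↔ c = y ∨ G.Adj y c) : ContainsInducedSubdivision house G := by
  by_contra hG
  have hC' := hC.replace (by omega) hv hx hvx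
  set C' : Set V := {c | c = v ∨ c ∈ C ∧ c ≠ x} with hC'def
  have hyC' : y ∈ C' := Or.inr ⟨hy, hxy.symm⟩
  have hwC' : w ∉ C' := by
    rintro (rfl | ⟨h, -⟩)
    · exact hvw.ne rfl
    · exact hw h
  obtain ⟨g, hg, rfl⟩ := hC'.exists_seq hyC'
  obtain ⟨l, hl, rfl⟩ := (hg.mem v).1 (Or.inl rfl)
  have hgC' : ∀ i < n, g i ∈ C' := fun i hi => (hg.mem _).2 ⟨i, hi, rfl⟩
  have hgeq : ∀ i < n, ∀ j < n, g i = g j ↔ i = j :=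
    fun i hi j hj => ⟨hg.inj i hi j hj, fun h => congrArg g h⟩
  have hl0 : ¬ (l = 0 ∨ CycAdj n l 0) := by
    rw [← hg.adj l hl 0 (by omega), ← hgeq l hl 0 (by omega)]
    rintro (h | h)
    · exact hv (h ▸ hy)
    · rw [hvx _ hy] at h
      exact h.elim (fun h => hxy h.symm) hnadj
  have hadj : ∀ i < n, G.Adj w (g i) ↔ i = l ∨ i = 0 ∨ CycAdj n 0 i := by
    intro i hi
    rw [← hg.adj 0 (by omega) i hi, ← hgeq i hi l hl, ← hgeq i hi 0 (by omega)]
    rcases hgC' i hi with h | ⟨h, -⟩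
    · simp only [h, hvw.symm, true_or]
    · have hne : g i ≠ g l := fun h' => hv (h' ▸ h)
      rw [hwy _ h]
      simp only [hne, false_or]
  obtain ⟨z, hz, hzl, hz0⟩ : ∃ z < n, z ≠ l ∧ ¬ (z = 0 ∨ CycAdj n 0 z) := by
    unfold CycAdj
    by_cases h : l = 2
    · exact ⟨3, by omega, by omega, by omega⟩
    · exact ⟨2, by omega, by omega, by omega⟩
  obtain ⟨u, hu, hatt⟩ := hC'.exists_attachesAt hG hn hwC' (hgC' z hz)
    (by rw [hadj z hz]; tauto) hyC' ((hadj 0 (by omega)).2 (Or.inr (Or.inl rfl)))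
  obtain ⟨k, hk, rfl⟩ := (hg.mem u).1 hu
  have hcyc : ∀ i < n, (i = l ∨ i = 0 ∨ CycAdj n 0 i) → i = k ∨ CycAdj n k i := by
    intro i hi h
    rw [← hadj i hi] at h
    rw [← hg.adj k hk i hi, ← hgeq i hi k hk]
    rcases hatt with hatt | hatt
    · exact Or.inl ((hatt _ (hgC' i hi)).1 h)
    · exact (hatt _ (hgC' i hi)).1 h
  have e0 := hcyc 0 (by omega)
  have e1 := hcyc 1 (by omega)
  have e2 := hcyc (n - 1) (by omega)
  have e3 := hcyc l hl
  unfold CycAdj at *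
  omega

/-- A hole with an induced path attached to it at distinct centres at its two ends contains a
subdivided house, unless both ends have three neighbours and the centres are adjacent. -/
theorem IsHole.house_of_attachesAt {n m : ℕ} {C : Set V} {x y : V} {p : ℕ → V}
    (hC : IsHole G n C) (hn : 5 ≤ n) (hx : x ∈ C) (hy : y ∈ C) (hxy : x ≠ y)
    (hp : IsPathSeq G m p) (hm : 2 ≤ m) (hpC : ∀ i < m, p i ∉ C)
    (hint : ∀ i, 0 < i → i + 1 < m → ∀ c ∈ C, ¬ G.Adj (p i) c)
    (hfirst : AttachesAt G C (p 0) x) (hlast : AttachesAt G C (p (m - 1)) y)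
    (hnadj : (∀ c ∈ C, G.Adj (p (m - 1)) c ↔ c = y) ∨ ¬ G.Adj x y) :
    ContainsInducedSubdivision house G := by
  have hfirst' := hfirst
  rcases hfirst with hfirst | hfirst
  · exact hC.house_of_single_attachesAt hn hx hy hxy hp hm hpC hint hfirst hlast
  have hsingle : (∀ c ∈ C, G.Adj (p (m - 1)) c ↔ c = y) →
      ContainsInducedSubdivision house G := fun h =>
    hC.house_of_single_attachesAt hn hy hx hxy.symm hp.reverse hm (fun i hi => hpC _ (by omega))
      (fun i hi him => hint _ (by omega) (by omega)) h
      (by rwa [show m - 1 - (m - 1) = 0 by omega])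
  rcases hlast with hlast | hlast
  · exact hsingle hlast
  rcases hnadj with hnadj | hnadj
  · exact hsingle hnadj
  rcases hm.eq_or_lt with rfl | hm
  · exact hC.house_of_adj_of_twins hn hx hy hxy hnadj (hpC 0 (by omega)) (hpC 1 (by omega))
      ((hp.adj 0 (by omega) 1 (by omega)).2 (by omega)) hfirst hlast
  · have h0 : p 0 ∉ C := hpC 0 (by omega)
    refine (hC.replace (by omega) h0 hx hfirst).house_of_single_attachesAt
      hn (x := p 0) (y := y) (m := m - 1) (Or.inl rfl) (Or.inr ⟨hy, hxy.symm⟩)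
      (fun h => h0 (h ▸ hy)) (hp.segment 1 (m - 1) (by omega)) (by omega) ?_ ?_ ?_ (Or.inr ?_)
    · rintro i hi (h | ⟨h, -⟩)
      · have := hp.inj _ (by omega) _ (by omega) h
        omega
      · exact hpC _ (by omega) h
    · rintro i hi him c (rfl | ⟨hc, -⟩)
      · rw [hp.adj _ (by omega) _ (by omega)]
        omega
      · exact hint _ (by omega) (by omega) c hc
    · rintro c (rfl | ⟨hc, -⟩)
      · simp only [iff_true]
        exact (hp.adj _ (by omega) _ (by omega)).2 (by omega)
      · have := hint 1 (by omega) (by omega) c hc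
        have hne : c ≠ p 0 := fun h => h0 (h ▸ hc)
        simp only [Nat.zero_add, this, hne]
    · rintro c (rfl | ⟨hc, -⟩)
      · have h1 : ¬ G.Adj y (p 0) := by
          rw [SimpleGraph.adj_comm, hfirst y hy]
          exact fun h => h.elim (fun h => hxy h.symm) hnadj
        have hne : p 0 ≠ y := fun h => h0 (h ▸ hy)
        rw [hp.adj _ (by omega) _ (by omega)]
        simp only [h1, hne, or_false, iff_false]
        omega
      · rw [show m - 1 - 1 + 1 = m - 1 by omega]
        exact hlast c hc

end Detours

section Crossing

variable {V : Type} {G : SimpleGraph V}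

/-- A walk inside `S` from `N₁` to `N₂` yields an induced path inside `S` of which only the first
vertex is in `N₁` and only the last one is in `N₂`. -/
theorem exists_isPathSeq {S N₁ N₂ : Set V} {m : ℕ} {p : ℕ → V} (hm : 1 ≤ m)
    (hS : ∀ i < m, p i ∈ S) (hadj : ∀ i, i + 1 < m → G.Adj (p i) (p (i + 1)))
    (h₁ : p 0 ∈ N₁) (h₂ : p (m - 1) ∈ N₂) :
    ∃ k q, 1 ≤ k ∧ IsPathSeq G k q ∧ (∀ i < k, q i ∈ S) ∧ (∀ i < k, q i ∈ N₁ ↔ i = 0) ∧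
      ∀ i < k, q i ∈ N₂ ↔ i + 1 = k := by
  classical
  have hex : ∃ k, ∃ q : ℕ → V, 1 ≤ k ∧ (∀ i < k, q i ∈ S) ∧
      (∀ i, i + 1 < k → G.Adj (q i) (q (i + 1))) ∧ q 0 ∈ N₁ ∧ q (k - 1) ∈ N₂ :=
    ⟨m, p, hm, hS, hadj, h₁, h₂⟩
  obtain ⟨k, ⟨q, hk, hS, hadj, h₁, h₂⟩, hmin⟩ : ∃ k, (∃ q : ℕ → V, 1 ≤ k ∧ (∀ i < k, q i ∈ S) ∧
      (∀ i, i + 1 < k → G.Adj (q i) (q (i + 1))) ∧ q 0 ∈ N₁ ∧ q (k - 1) ∈ N₂) ∧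
      ∀ l (r : ℕ → V), 1 ≤ l → (∀ i < l, r i ∈ S) →
        (∀ i, i + 1 < l → G.Adj (r i) (r (i + 1))) → r 0 ∈ N₁ → r (l - 1) ∈ N₂ → k ≤ l :=
    ⟨Nat.find hex, Nat.find_spec hex, fun l r a b c d e => Nat.find_min' hex ⟨r, a, b, c, d, e⟩⟩
  have hN₁ : ∀ i < k, q i ∈ N₁ → i = 0 := by
    intro i hi h
    have := hmin (k - i) (fun x => q (x + i)) (by omega) (fun x hx => hS _ (by omega))
      (fun x hx => by
        rw [show x + 1 + i = x + i + 1 by omega]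
        exact hadj _ (by omega))
      (by simpa using h) (by rwa [show k - i - 1 + i = k - 1 by omega])
    omega
  have hN₂ : ∀ i < k, q i ∈ N₂ → i + 1 = k := by
    intro i hi h
    have := hmin (i + 1) q (by omega) (fun x hx => hS _ (by omega))
      (fun x hx => hadj _ (by omega)) h₁ (by simpa using h)
    omega
  have hchord : ∀ x y, x + 2 ≤ y → y < k → ¬ G.Adj (q x) (q y) := by
    intro x y hxy hy h
    have := hmin (k - (y - x - 1)) (fun z => if z ≤ x then q z else q (z + (y - x - 1)))
      (by omega)
      (fun z hz => by
        split_ifs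
        · exact hS _ (by omega)
        · exact hS _ (by omega))
      (fun z hz => by
        split_ifs with h1 h2 h2
        · exact hadj _ (by omega)
        · rwa [show z = x by omega, show x + 1 + (y - x - 1) = y by omega]
        · omega
        · rw [show z + 1 + (y - x - 1) = z + (y - x - 1) + 1 by omega]
          exact hadj _ (by omega))
      (by simpa using h₁)
      (by rwa [if_neg (by omega), show k - (y - x - 1) - 1 + (y - x - 1) = k - 1 by omega])
    omega
  have hne : ∀ x y, x < y → y < k → q x ≠ q y := by
    intro x y hxy hy h
    by_cases hyk : y + 1 = k
    · rw [show k - 1 = y by omega, ← h] at h₂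
      have := hN₂ x (by omega) h₂
      omega
    · exact hchord x (y + 1) (by omega) (by omega) (h ▸ hadj y (by omega))
  refine ⟨k, q, hk, ⟨fun x hx y hy h => ?_, fun x hx y hy => ⟨fun h => ?_, ?_⟩⟩, hS,
    fun i hi => ⟨hN₁ i hi, ?_⟩, fun i hi => ⟨hN₂ i hi, ?_⟩⟩
  · rcases lt_trichotomy x y with hxy | hxy | hxy
    · exact absurd h (hne x y hxy hy)
    · exact hxy
    · exact absurd h.symm (hne y x hxy hx)
  · by_contra hcon
    rcases lt_trichotomy x y with hxy | rfl | hxy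
    · exact hchord x y (by omega) hy h
    · exact h.ne rfl
    · exact hchord y x (by omega) hx h.symm
  · rintro (rfl | rfl)
    · exact hadj x hy
    · exact (hadj y hx).symm
  · rintro rfl
    exact h₁
  · rintro rfl
    exact h₂

theorem exists_isPathSeq_of_preconnected {S N₁ N₂ : Set V} {a b : V}
    (hS : (G.induce S).Preconnected) (ha : a ∈ S) (hb : b ∈ S) (ha₁ : a ∈ N₁) (hb₂ : b ∈ N₂) :
    ∃ k q, 1 ≤ k ∧ IsPathSeq G k q ∧ (∀ i < k, q i ∈ S) ∧ (∀ i < k, q i ∈ N₁ ↔ i = 0) ∧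
      ∀ i < k, q i ∈ N₂ ↔ i + 1 = k := by
  obtain ⟨w⟩ := hS ⟨a, ha⟩ ⟨b, hb⟩
  exact exists_isPathSeq (m := w.length + 1) (p := fun i => (w.getVert i : V)) (by omega)
    (fun i _ => (w.getVert i).2) (fun i hi => w.adj_getVert_succ (by omega))
    (by simpa using ha₁) (by simpa using hb₂)

theorem AttachesAt.adj {C : Set V} {v x : V} (h : AttachesAt G C v x) (hx : x ∈ C) :
    G.Adj v x := by
  rcases h with h | h
  · exact (h x hx).2 rfl
  · exact (h x hx).2 (Or.inl rfl)

theorem AttachesAt.eq_or_adj {C : Set V} {v x c : V} (h : AttachesAt G C v x) (hc : c ∈ C)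
    (hvc : G.Adj v c) : c = x ∨ G.Adj x c := by
  rcases h with h | h
  · exact Or.inl ((h c hc).1 hvc)
  · exact (h c hc).1 hvc

/-- A walk off a hole joining the two sides `U` and `W` of the hole cut at the vertices `s` and
`t` forces a subdivided house, provided that no vertex of the walk with neighbours on both sides
is adjacent to `s` or `t`. -/
theorem IsHole.house_of_crossing {n m : ℕ} {C U W : Set V} {s t : V} {p : ℕ → V}
    (hC : IsHole G n C) (hn : 5 ≤ n) (hs : s ∈ C) (ht : t ∈ C) (hU : U ⊆ C) (hW : W ⊆ C)
    (hcover : ∀ c ∈ C, c = s ∨ c = t ∨ c ∈ U ∨ c ∈ W) (hsU : s ∉ U) (htU : t ∉ U)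
    (hdisj : ∀ c ∈ U, c ∉ W) (hanti : ∀ c ∈ U, ∀ d ∈ W, ¬ G.Adj c d)
    (hs₁ : ∃ c ∈ U, G.Adj s c) (hs₂ : ∃ c ∈ W, G.Adj s c) (ht₁ : ∃ c ∈ U, G.Adj t c)
    (ht₂ : ∃ c ∈ W, G.Adj t c) (hm : 1 ≤ m) (hpC : ∀ i < m, p i ∉ C)
    (hadj : ∀ i, i + 1 < m → G.Adj (p i) (p (i + 1))) (hfirst : ∃ c ∈ U, G.Adj (p 0) c)
    (hlast : ∃ c ∈ W, G.Adj (p (m - 1)) c)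
    (hboth : ∀ i < m, (∃ c ∈ U, G.Adj (p i) c) → (∃ c ∈ W, G.Adj (p i) c) →
      ¬ G.Adj (p i) s ∧ ¬ G.Adj (p i) t) : ContainsInducedSubdivision house G := by
  classical
  by_contra hG
  obtain ⟨k, q, hk, hq, hqS, hq₁, hq₂⟩ := exists_isPathSeq (G := G)
    (S := {v | v ∉ C ∧ ((∃ c ∈ U, G.Adj v c) → (∃ c ∈ W, G.Adj v c) → ¬ G.Adj v s ∧ ¬ G.Adj v t)})
    (N₁ := {v | ∃ c ∈ U, G.Adj v c}) (N₂ := {v | ∃ c ∈ W, G.Adj v c}) hm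
    (fun i hi => ⟨hpC i hi, hboth i hi⟩) hadj hfirst hlast
  obtain ⟨cU, hcU, hcUs⟩ := hs₁
  obtain ⟨cW, hcW, hcWs⟩ := hs₂
  obtain ⟨c, hc, h0c⟩ := (hq₁ 0 hk).2 rfl
  obtain ⟨d, hd, hkd⟩ := (hq₂ (k - 1) (by omega)).2 (by omega)
  rcases hk.eq_or_lt with rfl | hk
  · obtain ⟨h0s, h0t⟩ := (hqS 0 hk).2 ⟨c, hc, h0c⟩ ⟨d, hd, hkd⟩
    obtain ⟨x, hx, hatt⟩ := hC.exists_attachesAt hG hn (hqS 0 hk).1 hs h0s (hU hc) h0c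
    have hc' := hatt.eq_or_adj (hU hc) h0c
    have hd' := hatt.eq_or_adj (hW hd) hkd
    have h0x := hatt.adj hx
    rcases hcover x hx with rfl | rfl | hxU | hxW
    · exact h0s h0x
    · exact h0t h0x
    · rcases hd' with rfl | h
      · exact hdisj d hxU hd
      · exact hanti x hxU d hd h
    · rcases hc' with rfl | h
      · exact hdisj c hc hxW
      · exact hanti c hc x hxW h.symm
  have h0W : ∀ e ∈ W, ¬ G.Adj (q 0) e := fun e he h => by
    have := (hq₂ 0 (by omega)).1 ⟨e, he, h⟩
    omega
  obtain ⟨x, hx, hattx⟩ := hC.exists_attachesAt hG hn (hqS 0 (by omega)).1 (hW hcW) (h0W cW hcW)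
    (hU hc) h0c
  have hxout : ∀ v ∈ C, v ∉ U → (∃ e ∈ W, G.Adj v e) → x ≠ v := by
    rintro v hv hvU ⟨e, he, hve⟩ rfl
    rcases hattx with h | h
    · exact hvU ((h c (hU hc)).1 h0c ▸ hc)
    · exact h0W e he ((h e (hW he)).2 (Or.inr hve))
  have hxU : x ∈ U := by
    rcases hcover x hx with h | h | h | h
    · exact absurd h (hxout s hs hsU ⟨cW, hcW, hcWs⟩)
    · exact absurd h (hxout t ht htU ht₂)
    · exact h
    · exact absurd (hattx.adj hx) (h0W x h)
  have hex : ∃ i, 0 < i ∧ i < k ∧ ∃ e ∈ C, G.Adj (q i) e :=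
    ⟨k - 1, by omega, by omega, d, hW hd, hkd⟩
  obtain ⟨i, ⟨hi0, hik, e, he, hie⟩, hmin⟩ : ∃ i, (0 < i ∧ i < k ∧ ∃ e ∈ C, G.Adj (q i) e) ∧
      ∀ j, 0 < j → j < k → (∃ e ∈ C, G.Adj (q j) e) → i ≤ j :=
    ⟨Nat.find hex, Nat.find_spec hex, fun j h1 h2 h3 => Nat.find_min' hex ⟨h1, h2, h3⟩⟩
  have hiU : ∀ e ∈ U, ¬ G.Adj (q i) e := fun e he h => by
    have := (hq₁ i hik).1 ⟨e, he, h⟩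
    omega
  obtain ⟨y, hy, hatty⟩ := hC.exists_attachesAt hG hn (hqS i hik).1 (hU hcU) (hiU cU hcU) he hie
  have hyU : y ∉ U := fun h => hiU y h (hatty.adj hy)
  have hysingle : (∃ f ∈ U, G.Adj y f) → ∀ f ∈ C, G.Adj (q i) f ↔ f = y := by
    rintro ⟨f, hf, hyf⟩
    rcases hatty with h | h
    · exact h
    · exact absurd ((h f (hU hf)).2 (Or.inr hyf)) (hiU f hf)
  refine hG (hC.house_of_attachesAt hn hx hy (fun h => hyU (h ▸ hxU))
    (hq.segment 0 (i + 1) (by omega)) (by omega) (fun j hj => (hqS _ (by omega)).1) ?_ hattx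
    (by simpa using hatty) ?_)
  · intro j hj0 hji f hf h
    have := hmin j hj0 (by omega) ⟨f, hf, h⟩
    omega
  · simp only [Nat.add_sub_cancel, Nat.add_zero]
    rcases hcover y hy with rfl | rfl | h | h
    · exact Or.inl (hysingle ⟨cU, hcU, hcUs⟩)
    · exact Or.inl (hysingle ht₁)
    · exact absurd h hyU
    · exact Or.inr (hanti x hxU y h)

/-- Two induced paths joined at both ends form a hole. -/
theorem IsPathSeq.isHole_join {k l : ℕ} {u b : ℕ → V} (hu : IsPathSeq G k u)
    (hb : IsPathSeq G l b) (hk : 2 ≤ k) (hl : 1 ≤ l) (hdisj : ∀ x < k, ∀ y < l, u x ≠ b y)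
    (hadj : ∀ x < k, ∀ y < l,
      G.Adj (u x) (b y) ↔ (x + 1 = k ∧ y = 0) ∨ (x = 0 ∧ y + 1 = l)) :
    IsHole G (k + l) {c | (∃ x < k, u x = c) ∨ ∃ y < l, b y = c} := by
  refine ⟨fun x => if x < k then u x else b (x - k), ⟨?_, ?_, ?_⟩⟩
  · intro x hx y hy h
    split_ifs at h with h1 h2 h2
    · exact hu.inj x h1 y h2 h
    · exact absurd h (hdisj x h1 _ (by omega))
    · exact absurd h.symm (hdisj y h2 _ (by omega))
    · have := hb.inj _ (by omega) _ (by omega) h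
      omega
  · intro x hx y hy
    unfold CycAdj
    split_ifs with h1 h2 h2
    · rw [hu.adj x h1 y h2]
      omega
    · rw [hadj x h1 _ (by omega)]
      omega
    · rw [SimpleGraph.adj_comm, hadj y h2 _ (by omega)]
      omega
    · rw [hb.adj _ (by omega) _ (by omega)]
      omega
  · intro c
    constructor
    · rintro (⟨x, hx, rfl⟩ | ⟨y, hy, rfl⟩)
      · exact ⟨x, by omega, if_pos hx⟩
      · exact ⟨y + k, by omega, by simp⟩
    · rintro ⟨x, hx, rfl⟩
      split_ifs with h
      · exact Or.inl ⟨x, h, rfl⟩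
      · exact Or.inr ⟨x - k, by omega, rfl⟩

/-- Anticomplete connected sets `A` and `B` joined through three pairwise anticomplete connected
sets `P`, `Q`, `R`, such that no vertex of `R` sees both `A` and `B`, force a subdivided house. -/
theorem house_of_three_connections {A B P Q R : Set V}
    (hA : (G.induce A).Connected) (hB : (G.induce B).Connected) (hP : (G.induce P).Connected)
    (hQ : (G.induce Q).Connected) (hR : (G.induce R).Connected)
    (dAB : Disjoint A B) (dAQ : Disjoint A Q) (dAR : Disjoint A R) (dBQ : Disjoint B Q)
    (dBR : Disjoint B R) (dPQ : Disjoint P Q) (dPR : Disjoint P R) (dQR : Disjoint Q R)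
    (nAB : ∀ a ∈ A, ∀ b ∈ B, ¬ G.Adj a b) (nPQ : ∀ a ∈ P, ∀ b ∈ Q, ¬ G.Adj a b)
    (nPR : ∀ a ∈ P, ∀ b ∈ R, ¬ G.Adj a b) (nQR : ∀ a ∈ Q, ∀ b ∈ R, ¬ G.Adj a b)
    (eAP : ∃ a ∈ A, ∃ b ∈ P, G.Adj a b) (eAQ : ∃ a ∈ A, ∃ b ∈ Q, G.Adj a b)
    (eAR : ∃ a ∈ A, ∃ b ∈ R, G.Adj a b) (eBP : ∃ a ∈ B, ∃ b ∈ P, G.Adj a b)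
    (eBQ : ∃ a ∈ B, ∃ b ∈ Q, G.Adj a b) (eBR : ∃ a ∈ B, ∃ b ∈ R, G.Adj a b)
    (hRAB : ∀ r ∈ R, (∃ a ∈ A, G.Adj r a) → ¬ ∃ b ∈ B, G.Adj r b) :
    ContainsInducedSubdivision house G := by
  classical
  have hjoin : ∀ {S T : Set V}, (G.induce S).Connected → (G.induce T).Connected →
      (∃ a ∈ S, ∃ b ∈ T, G.Adj a b) → (G.induce (S ∪ T)).Connected := by
    rintro S T hS hT ⟨a, ha, b, hb, hab⟩
    exact SimpleGraph.connected_induce_union hS.preconnected hT.preconnected ha hb hab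
  have hQAR : (G.induce ((A ∪ Q) ∪ R)).Connected := by
    obtain ⟨a, ha, b, hb, hab⟩ := eAR
    exact hjoin (hjoin hA hQ eAQ) hR ⟨a, Or.inl ha, b, hb, hab⟩
  have hAPB : (G.induce ((A ∪ P) ∪ B)).Connected := by
    obtain ⟨a, ha, b, hb, hab⟩ := eBP
    exact hjoin (hjoin hA hP eAP) hB ⟨b, Or.inr hb, a, ha, hab.symm⟩
  rw [Set.disjoint_left] at dAB dAQ dAR dBQ dBR dPQ dPR dQR
  obtain ⟨b₁, hb₁, q, hq, hbq⟩ := eBQ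
  obtain ⟨b₂, hb₂, r, hr, hbr⟩ := eBR
  obtain ⟨k, u, hk, hu, huS, hu₁, hu₂⟩ := exists_isPathSeq_of_preconnected
    (N₁ := {v | v ∈ Q ∧ ∃ b ∈ B, G.Adj v b}) (N₂ := {v | v ∈ R ∧ ∃ b ∈ B, G.Adj v b})
    hQAR.preconnected (Or.inl (Or.inr hq)) (Or.inr hr) ⟨hq, b₁, hb₁, hbq.symm⟩
    ⟨hr, b₂, hb₂, hbr.symm⟩
  obtain ⟨hu0Q, c₁, hc₁, huc₁⟩ := (hu₁ 0 (by omega)).2 rfl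
  obtain ⟨hukR, c₂, hc₂, huc₂⟩ := (hu₂ (k - 1) (by omega)).2 (by omega)
  have huint : ∀ i, 0 < i → i + 1 < k → ∀ b ∈ B, ¬ G.Adj (u i) b := by
    intro i hi0 hik b hb h
    rcases huS i (by omega) with (hiA | hiQ) | hiR
    · exact nAB _ hiA b hb h
    · have := (hu₁ i (by omega)).1 ⟨hiQ, b, hb, h⟩
      omega
    · have := (hu₂ i (by omega)).1 ⟨hiR, b, hb, h⟩
      omega
  have hk4 : 4 ≤ k := by
    by_contra hcon
    have : k = 1 ∨ k = 2 ∨ k = 3 := by omega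
    rcases this with rfl | rfl | rfl
    · exact dQR hu0Q hukR
    · exact nQR _ hu0Q _ hukR ((hu.adj 0 (by omega) 1 (by omega)).2 (by omega))
    · have h01 := (hu.adj 0 (by omega) 1 (by omega)).2 (by omega)
      have h21 := (hu.adj 2 (by omega) 1 (by omega)).2 (by omega)
      rcases huS 1 (by omega) with (h | h) | h
      · exact hRAB _ hukR ⟨_, h, h21⟩ ⟨c₂, hc₂, huc₂⟩
      · exact nQR _ h _ hukR h21.symm
      · exact nQR _ hu0Q _ h h01
  obtain ⟨i, hi0, hik, hiA⟩ : ∃ i, 0 < i ∧ i + 1 < k ∧ u i ∈ A := by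
    have hex : ∃ i, i < k ∧ u i ∉ Q := ⟨k - 1, by omega, fun h => dQR h hukR⟩
    obtain ⟨hik, hiQ⟩ := Nat.find_spec hex
    have hi0 : 0 < Nat.find hex := by
      rw [Nat.find_pos]
      exact fun h => h.2 hu0Q
    have hpred : u (Nat.find hex - 1) ∈ Q := by
      by_contra h
      exact Nat.find_min hex (m := Nat.find hex - 1) (by omega) ⟨by omega, h⟩
    generalize Nat.find hex = i at *
    have hiA : u i ∈ A := by
      rcases huS i hik with (h | h) | h
      · exact h
      · exact absurd h hiQ
      · exact absurd ((hu.adj (i - 1) (by omega) i hik).2 (by omega)) (nQR _ hpred _ h)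
    refine ⟨i, hi0, ?_, hiA⟩
    by_contra hcon
    rw [show i = k - 1 by omega] at hiA
    exact dAR hiA hukR
  obtain ⟨l, b, hl, hb, hbB, hb₁', hb₂'⟩ := exists_isPathSeq_of_preconnected
    (N₁ := {v | G.Adj (u (k - 1)) v}) (N₂ := {v | G.Adj (u 0) v})
    hB.preconnected hc₂ hc₁ huc₂ huc₁
  simp only [Set.mem_ofPred_eq] at hb₁' hb₂'
  have huB : ∀ x < k, u x ∉ B := by
    intro x hx h
    rcases huS x hx with (h' | h') | h'
    · exact dAB h' h
    · exact dBQ h h'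
    · exact dBR h h'
  have hC := hu.isHole_join hb (by omega) hl (fun x hx y hy h => huB x hx (h ▸ hbB y hy)) (by
    intro x hx y hy
    by_cases hx0 : x = 0
    · subst hx0
      rw [hb₂' y hy]
      omega
    · by_cases hxk : x = k - 1
      · subst hxk
        rw [hb₁' y hy]
        omega
      · have := huint x (by omega) (by omega) _ (hbB y hy)
        simp only [this, false_iff]
        omega)
  have hsep : ∀ c, (∃ x, 0 < x ∧ x + 1 < k ∧ u x = c) → ∀ d, (∃ y < l, b y = d) →
      c ≠ d ∧ ¬ G.Adj c d := by
    rintro _ ⟨x, hx0, hxk, rfl⟩ _ ⟨y, hy, rfl⟩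
    exact ⟨fun h => huB x (by omega) (h ▸ hbB y hy), huint x hx0 hxk _ (hbB y hy)⟩
  obtain ⟨m, p, hm, hp, hpS, hp₁, hp₂⟩ := exists_isPathSeq_of_preconnected
    (N₁ := {c | ∃ x, 0 < x ∧ x + 1 < k ∧ u x = c}) (N₂ := {c | ∃ y < l, b y = c})
    hAPB.preconnected (Or.inl (Or.inl hiA)) (Or.inr (hbB 0 hl)) ⟨i, hi0, hik, rfl⟩
    ⟨0, hl, rfl⟩
  have hp0 := (hp₁ 0 (by omega)).2 rfl
  have hpm := (hp₂ (m - 1) (by omega)).2 (by omega)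
  have hm3 : 3 ≤ m := by
    have hsep' := hsep _ hp0 _ hpm
    by_contra hcon
    have : m = 1 ∨ m = 2 := by omega
    rcases this with rfl | rfl
    · exact hsep'.1 rfl
    · exact hsep'.2 ((hp.adj 0 (by omega) 1 (by omega)).2 (by omega))
  have hpQR : ∀ j < m, p j ∉ Q ∧ p j ∉ R := by
    intro j hj
    rcases hpS j hj with (h | h) | h
    · exact ⟨dAQ h, dAR h⟩
    · exact ⟨dPQ h, dPR h⟩
    · exact ⟨dBQ h, dBR h⟩
  refine hC.house_of_crossing (U := {c | ∃ x, 0 < x ∧ x + 1 < k ∧ u x = c})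
    (W := {c | ∃ y < l, b y = c}) (s := u 0) (t := u (k - 1)) (m := m - 2)
    (p := fun j => p (j + 1)) (by omega) (Or.inl ⟨0, by omega, rfl⟩)
    (Or.inl ⟨k - 1, by omega, rfl⟩) ?_ (fun c hc => Or.inr hc) ?_ ?_ ?_
    (fun c hc hc' => (hsep c hc c hc').1 rfl) (fun c hc d hd => (hsep c hc d hd).2)
    ⟨u 1, ⟨1, by omega, by omega, rfl⟩, (hu.adj _ (by omega) _ (by omega)).2 (by omega)⟩
    ⟨b (l - 1), ⟨l - 1, by omega, rfl⟩, (hb₂' _ (by omega)).2 (by omega)⟩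
    ⟨u (k - 2), ⟨k - 2, by omega, by omega, rfl⟩,
      (hu.adj _ (by omega) _ (by omega)).2 (by omega)⟩
    ⟨b 0, ⟨0, by omega, rfl⟩, (hb₁' _ (by omega)).2 rfl⟩ (by omega) ?_
    (fun j hj => (hp.adj _ (by omega) _ (by omega)).2 (by omega))
    ⟨p 0, hp0, (hp.adj _ (by omega) _ (by omega)).2 (by omega)⟩
    ⟨p (m - 1), hpm, (hp.adj _ (by omega) _ (by omega)).2 (by omega)⟩ ?_
  · rintro _ ⟨x, hx0, hxk, rfl⟩
    exact Or.inl ⟨x, by omega, rfl⟩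
  · rintro _ (⟨x, hx, rfl⟩ | h)
    · by_cases hx0 : x = 0
      · exact Or.inl (by rw [hx0])
      · by_cases hxk : x = k - 1
        · exact Or.inr (Or.inl (by rw [hxk]))
        · exact Or.inr (Or.inr (Or.inl ⟨x, by omega, by omega, rfl⟩))
    · exact Or.inr (Or.inr (Or.inr h))
  · rintro ⟨x, hx0, hxk, h⟩
    have := hu.inj _ (by omega) _ (by omega) h
    omega
  · rintro ⟨x, hx0, hxk, h⟩
    have := hu.inj _ (by omega) _ (by omega) h
    omega
  · rintro j hj (⟨x, hx, h⟩ | h)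
    · by_cases hx0 : x = 0
      · exact (hpQR (j + 1) (by omega)).1 (by rw [← h, hx0]; exact hu0Q)
      · by_cases hxk : x = k - 1
        · exact (hpQR (j + 1) (by omega)).2 (by rw [← h, hxk]; exact hukR)
        · have := (hp₁ (j + 1) (by omega)).1 ⟨x, by omega, by omega, h⟩
          omega
    · have := (hp₂ (j + 1) (by omega)).1 h
      omega
  · rintro j hj ⟨_, ⟨x, hx0, hxk, rfl⟩, hx⟩ ⟨_, ⟨y, hy, rfl⟩, hy'⟩
    rcases hpS (j + 1) (by omega) with (h | h) | h
    · exact absurd hy' (nAB _ h _ (hbB y hy))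
    · exact ⟨nPQ _ h _ hu0Q, nPR _ h _ hukR⟩
    · exact absurd hx.symm (huint x hx0 hxk _ h)

end Crossing

theorem house_subdivision_free_no_gamma223 {V : Type} [Fintype V]
    (G : SimpleGraph V) (h : ¬ ContainsInducedSubdivision house G) :
    ¬ InducedMinor (gammaGraph 1 1 2) G := by
  rintro ⟨X, -, hconn, hdisj, hedge, hnon⟩
  have hd : ∀ v w, v ≠ w → Disjoint (X v) (X w) := fun v w hvw => hdisj hvw
  have hr : ∃ a ∈ X (.inr (.inr (.inr 0))), ∃ b ∈ X (.inr (.inr (.inr 1))), G.Adj a b :=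
    hedge _ _ (by simp [gammaGraph])
  have hnr : ∀ v, v ≠ .inr (.inr (.inr 0)) → v ≠ .inr (.inr (.inr 1)) →
      ¬ (gammaGraph 1 1 2).Adj v (.inr (.inr (.inr 0))) →
      ¬ (gammaGraph 1 1 2).Adj v (.inr (.inr (.inr 1))) →
      ∀ a ∈ X v, ∀ b ∈ X (.inr (.inr (.inr 0))) ∪ X (.inr (.inr (.inr 1))), ¬ G.Adj a b := by
    rintro v h0 h1 n0 n1 a ha b (hb | hb)
    · exact hnon _ _ h0 n0 a ha b hb
    · exact hnon _ _ h1 n1 a ha b hb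
  refine h (house_of_three_connections (A := X (.inl 0)) (B := X (.inl 1)) (P := X (.inr (.inl 0)))
    (Q := X (.inr (.inr (.inl 0)))) (R := X (.inr (.inr (.inr 0))) ∪ X (.inr (.inr (.inr 1))))
    (hconn _) (hconn _) (hconn _) (hconn _) ?_
    (hd _ _ (by simp)) (hd _ _ (by simp))
    (Set.disjoint_union_right.2 ⟨hd _ _ (by simp), hd _ _ (by simp)⟩) (hd _ _ (by simp))
    (Set.disjoint_union_right.2 ⟨hd _ _ (by simp), hd _ _ (by simp)⟩) (hd _ _ (by simp))
    (Set.disjoint_union_right.2 ⟨hd _ _ (by simp), hd _ _ (by simp)⟩)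
    (Set.disjoint_union_right.2 ⟨hd _ _ (by simp), hd _ _ (by simp)⟩)
    (hnon _ _ (by simp) (by simp [gammaGraph])) (hnon _ _ (by simp) (by simp [gammaGraph]))
    (hnr _ (by simp) (by simp) (by simp [gammaGraph]) (by simp [gammaGraph]))
    (hnr _ (by simp) (by simp) (by simp [gammaGraph]) (by simp [gammaGraph]))
    (hedge _ _ (by simp [gammaGraph])) (hedge _ _ (by simp [gammaGraph])) ?_
    (hedge _ _ (by simp [gammaGraph])) (hedge _ _ (by simp [gammaGraph])) ?_ ?_)
  · obtain ⟨a, ha, b, hb, hab⟩ := hr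
    exact SimpleGraph.connected_induce_union (hconn _).preconnected (hconn _).preconnected ha hb hab
  · obtain ⟨a, ha, b, hb, hab⟩ := hedge (.inl 0) (.inr (.inr (.inr 0))) (by simp [gammaGraph])
    exact ⟨a, ha, b, Or.inl hb, hab⟩
  · obtain ⟨a, ha, b, hb, hab⟩ := hedge (.inl 1) (.inr (.inr (.inr 1))) (by simp [gammaGraph])
    exact ⟨a, ha, b, Or.inr hb, hab⟩
  · rintro r (hr | hr) ⟨a, ha, hra⟩ ⟨b, hb, hrb⟩
    · exact hnon _ _ (by simp) (by simp [gammaGraph]) r hr b hb hrb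
    · exact hnon _ _ (by simp) (by simp [gammaGraph]) r hr a ha hra
end

section
/- The class of all finite simple graphs that do not contain an induced subdivision of the house is tame. -/
open SimpleGraph

/-! ### Theta graphs as subdivisions of the house -/

/-- Potential vertices of a theta graph: two branch vertices `inl false`, `inl true`, and for each
of the three paths a sequence of internal vertices. -/
abbrev ThetaVertex := Bool ⊕ (Fin 3 × ℕ)

/-- The vertices of the theta graph whose paths have `ℓ 0`, `ℓ 1`, `ℓ 2` internal vertices. -/
def thetaValid (ℓ : Fin 3 → ℕ) : ThetaVertex → Prop
  | Sum.inl _ => True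
  | Sum.inr (i, j) => j < ℓ i

/-- Adjacency in the theta graph whose paths have `ℓ 0`, `ℓ 1`, `ℓ 2` internal vertices. -/
def thetaAdj (ℓ : Fin 3 → ℕ) : ThetaVertex → ThetaVertex → Prop
  | Sum.inl a, Sum.inl b => a ≠ b ∧ ∃ i, ℓ i = 0
  | Sum.inl false, Sum.inr (_, j) => j = 0
  | Sum.inl true, Sum.inr (i, j) => j + 1 = ℓ i
  | Sum.inr (_, j), Sum.inl false => j = 0
  | Sum.inr (i, j), Sum.inl true => j + 1 = ℓ i
  | Sum.inr (i, j), Sum.inr (i', j') => i = i' ∧ (j + 1 = j' ∨ j' + 1 = j)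

/-- Some subdivision of the house is the theta graph with path lengths given by `ℓ`. -/
def HouseSubdividesToTheta (ℓ : Fin 3 → ℕ) : Prop :=
  ∃ (B : Type) (K : SimpleGraph B) (g : B → ThetaVertex), Subdivision house K ∧
    Function.Injective g ∧ (∀ v, thetaValid ℓ v ↔ v ∈ Set.range g) ∧
    ∀ a b, K.Adj a b ↔ thetaAdj ℓ (g a) (g b)

lemma houseSubdividesToTheta_base : HouseSubdividesToTheta ![0, 1, 2] := by
  refine ⟨Fin 5, house, ![Sum.inl false, Sum.inr (2, 0), Sum.inr (2, 1), Sum.inl true,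
    Sum.inr (1, 0)], Subdivision.refl _, by decide, ?_, ?_⟩
  · rintro (b | ⟨i, j⟩)
    · cases b
      · exact ⟨fun _ => ⟨0, rfl⟩, fun _ => trivial⟩
      · exact ⟨fun _ => ⟨3, rfl⟩, fun _ => trivial⟩
    · constructor
      · intro h
        fin_cases i
        · simp [thetaValid] at h
        · obtain rfl : j = 0 := by simpa [thetaValid] using h
          exact ⟨4, rfl⟩
        · have h' : j < 2 := by simpa [thetaValid] using h
          interval_cases j
          · exact ⟨1, rfl⟩
          · exact ⟨2, rfl⟩
      · rintro ⟨k, hk⟩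
        fin_cases k <;> simp at hk <;> obtain ⟨rfl, rfl⟩ := hk <;> simp [thetaValid]
  · intro a b
    fin_cases a <;> fin_cases b <;> simp [house, thetaAdj, Fin.exists_fin_succ]

lemma HouseSubdividesToTheta.comp_perm {ℓ : Fin 3 → ℕ} (h : HouseSubdividesToTheta ℓ)
    (σ : Equiv.Perm (Fin 3)) : HouseSubdividesToTheta (ℓ ∘ σ) := by
  obtain ⟨B, K, g, hK, hg, hr, ha⟩ := h
  refine ⟨B, K, Sum.map id (Prod.map σ.symm id) ∘ g, hK,
    (Function.injective_id.sumMap (σ.symm.injective.prodMap Function.injective_id)).comp hg,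
    ?_, ?_⟩
  · intro v
    have key : thetaValid (ℓ ∘ σ) v ↔ thetaValid ℓ (Sum.map id (Prod.map σ id) v) := by
      rcases v with b | ⟨i, j⟩ <;> simp [thetaValid]
    rw [key, hr]
    constructor
    · rintro ⟨b, hb⟩
      exact ⟨b, by rcases v with b | ⟨i, j⟩ <;> simp [hb]⟩
    · rintro ⟨b, rfl⟩
      refine ⟨b, ?_⟩
      rcases hgb : g b with b | ⟨i, j⟩ <;> simp [hgb]
  · intro a b
    rw [ha]
    have hex : (∃ i, ℓ i = 0) ↔ ∃ i, ℓ (σ i) = 0 :=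
      ⟨fun ⟨i, hi⟩ => ⟨σ.symm i, by simpa using hi⟩, fun ⟨i, hi⟩ => ⟨_, hi⟩⟩
    simp only [Function.comp_apply]
    generalize g a = x
    generalize g b = y
    rcases x with (_ | _) | ⟨i, j⟩ <;> rcases y with (_ | _) | ⟨i', j'⟩ <;>
      simp [thetaAdj, hex]

lemma HouseSubdividesToTheta.succ {ℓ : Fin 3 → ℕ} (h : HouseSubdividesToTheta ℓ) (i : Fin 3)
    (hi : ℓ i = 0 → ∀ i' ≠ i, ℓ i' ≠ 0) :
    HouseSubdividesToTheta (Function.update ℓ i (ℓ i + 1)) := by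
  obtain ⟨B, K, g, hK, hg, hr, ha⟩ := h
  obtain ⟨v, hv⟩ := (hr (Sum.inl true)).1 trivial
  have hu' : ∃ w, thetaValid ℓ w ∧ thetaAdj ℓ w (Sum.inl true) ∧
      (ℓ i = 0 ∧ w = Sum.inl false ∨ ∃ j, j + 1 = ℓ i ∧ w = Sum.inr (i, j)) := by
    rcases hl : ℓ i with _ | k
    · exact ⟨Sum.inl false, trivial, ⟨by simp, i, hl⟩, Or.inl ⟨rfl, rfl⟩⟩
    · exact ⟨Sum.inr (i, k), by simp [thetaValid, hl], by simp [thetaAdj, hl],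
        Or.inr ⟨k, rfl, rfl⟩⟩
  obtain ⟨w, hw, hwa, hwc⟩ := hu'
  obtain ⟨u, hu⟩ := (hr w).1 hw
  have huv : K.Adj u v := by rw [ha, hu, hv]; exact hwa
  have hval : ∀ b, thetaValid ℓ (g b) := fun b => (hr _).2 ⟨b, rfl⟩
  refine ⟨Option B, subdivideEdge K u v, fun o => o.elim (Sum.inr (i, ℓ i)) g,
    hK.step huv, ?_, ?_, ?_⟩
  · have hne : ∀ b, g b ≠ Sum.inr (i, ℓ i) := by
      intro b hb
      have := hval b
      simp [hb, thetaValid] at this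
    rintro (_ | a) (_ | b) hab
    · rfl
    · exact absurd hab.symm (hne b)
    · exact absurd hab (hne a)
    · exact congrArg some (hg hab)
  · intro x
    constructor
    · intro hx
      by_cases hx' : x = Sum.inr (i, ℓ i)
      · exact ⟨none, hx'.symm⟩
      · have : thetaValid ℓ x := by
          rcases x with b | ⟨i', j⟩
          · trivial
          · by_cases hii : i' = i
            · subst hii
              simp [thetaValid] at hx hx' ⊢
              omega
            · simpa [thetaValid, Function.update_of_ne hii] using hx
        obtain ⟨b, hb⟩ := (hr x).1 this
        exact ⟨some b, hb⟩
    · rintro ⟨_ | b, rfl⟩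
      · simp [thetaValid]
      · have := hval b
        simp only [Option.elim]
        generalize g b = x at this
        rcases x with b | ⟨i', j⟩
        · trivial
        · by_cases hii : i' = i
          · subst hii
            simp [thetaValid] at this ⊢
            omega
          · simpa [thetaValid, Function.update_of_ne hii] using this
  · have hnone : ∀ b, (b = u ∨ b = v) ↔
        thetaAdj (Function.update ℓ i (ℓ i + 1)) (Sum.inr (i, ℓ i)) (g b) := by
      intro b
      rw [← hg.eq_iff, ← hg.eq_iff (b := v), hu, hv]
      have := hval b
      rcases hgb : g b with (_ | _) | ⟨i', j⟩
      · rcases hwc with ⟨h0, rfl⟩ | ⟨j, hj, rfl⟩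
        · simp [thetaAdj, h0]
        · simp [thetaAdj]; omega
      · rcases hwc with ⟨h0, rfl⟩ | ⟨j, hj, rfl⟩ <;> simp [thetaAdj]
      · rw [hgb] at this
        simp only [thetaValid] at this
        rcases hwc with ⟨h0, rfl⟩ | ⟨k, hj, rfl⟩
        · simp [thetaAdj]
          rintro rfl
          omega
        · simp only [thetaAdj, Sum.inr.injEq, Prod.mk.injEq]
          constructor
          · rintro (⟨rfl, rfl⟩ | h)
            · exact ⟨rfl, Or.inr hj⟩
            · simp at h
          · rintro ⟨rfl, h⟩
            exact Or.inl ⟨rfl, by omega⟩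
    have hsymm : ∀ (ℓ : Fin 3 → ℕ) x y, thetaAdj ℓ x y → thetaAdj ℓ y x := by
      rintro ℓ ((_ | _) | ⟨i, j⟩) ((_ | _) | ⟨i', j'⟩) <;> grind [thetaAdj]
    have hirr : ∀ (ℓ : Fin 3 → ℕ) x, ¬ thetaAdj ℓ x x := by
      rintro ℓ ((_ | _) | ⟨i, j⟩) <;> simp [thetaAdj]
    rintro (_ | a) (_ | b)
    · simp [hirr]
    · have : (subdivideEdge K u v).Adj none (some b) ↔ (b = u ∨ b = v) := by
        simp [subdivideEdge]
      rw [this]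
      exact hnone b
    · have : (subdivideEdge K u v).Adj (some a) none ↔ (a = u ∨ a = v) := by
        simp [subdivideEdge]
      rw [this, hnone a]
      exact ⟨hsymm _ _ _, hsymm _ _ _⟩
    · have h1 : (subdivideEdge K u v).Adj (some a) (some b) ↔
          K.Adj a b ∧ ¬(a = u ∧ b = v) ∧ ¬(a = v ∧ b = u) := by
        have := K.adj_comm a b
        have := K.ne_of_adj (a := a) (b := b)
        simp only [subdivideEdge, fromRel_adj]
        simp
        grind
      rw [h1, ha]
      simp only [← hg.eq_iff, hu, hv, Option.elim]
      have h2 := hval a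
      have h3 := hval b
      generalize g a = x at *
      generalize g b = y at *
      have hupd : ∀ i', Function.update ℓ i (ℓ i + 1) i' = if i' = i then ℓ i + 1 else ℓ i' := by
        intro i'; simp [Function.update_apply]
      have hex : (∃ i', (if i' = i then ℓ i + 1 else ℓ i') = 0) ↔ ∃ i' ≠ i, ℓ i' = 0 := by
        grind
      clear hr ha hval hnone hsymm hirr h1 huv hv hu hwa hw
      rcases x with (_ | _) | ⟨i1, j1⟩ <;> rcases y with (_ | _) | ⟨i2, j2⟩ <;>
        simp only [thetaAdj, thetaValid, hupd, hex] at h2 h3 ⊢ <;>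
        rcases hwc with ⟨h0, rfl⟩ | ⟨k, hj, rfl⟩ <;> grind

lemma HouseSubdividesToTheta.lengthen {ℓ : Fin 3 → ℕ} (h : HouseSubdividesToTheta ℓ) (i : Fin 3)
    (hi : ℓ i = 0 → ∀ i' ≠ i, ℓ i' ≠ 0) (k : ℕ) :
    HouseSubdividesToTheta (Function.update ℓ i (ℓ i + k)) := by
  induction k with
  | zero => simpa using h
  | succ k ih =>
    have := ih.succ i (by
      intro h0 i' hi'
      rw [Function.update_of_ne hi']
      exact hi (by simp at h0; omega) i' hi')
    simpa [add_assoc] using this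

lemma houseSubdividesToTheta_of_le {p q r : ℕ} (hq : 1 ≤ q) (hr : 2 ≤ r) :
    HouseSubdividesToTheta ![p, q, r] := by
  have h := ((houseSubdividesToTheta_base.lengthen 2 (by simp) (r - 2)).lengthen 1 (by simp)
    (q - 1)).lengthen 0
    (by intro _ i' hi'; fin_cases i' <;> simp at hi' ⊢) p
  convert h using 1
  funext i
  fin_cases i <;> simp <;> omega

/-- An induced theta in `G` whose paths have `p`, `q ≥ 1` and `r ≥ 2` internal vertices, in some
order, is an induced subdivision of the house. -/
lemma containsInducedSubdivision_house_of_theta_s9 {V : Type} {G : SimpleGraph V} {x y : V}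
    {ℓ : Fin 3 → ℕ} (P : Fin 3 → ℕ → V) (hℓ : HouseSubdividesToTheta ℓ) (hxy : x ≠ y)
    (hadj : G.Adj x y ↔ ∃ i, ℓ i = 0)
    (hx : ∀ i, ∀ j < ℓ i, P i j ≠ x ∧ (G.Adj x (P i j) ↔ j = 0))
    (hy : ∀ i, ∀ j < ℓ i, P i j ≠ y ∧ (G.Adj y (P i j) ↔ j + 1 = ℓ i))
    (hP : ∀ i, ∀ j < ℓ i, ∀ i', ∀ j' < ℓ i', (P i j = P i' j' → i = i' ∧ j = j') ∧
      (G.Adj (P i j) (P i' j') ↔ i = i' ∧ (j + 1 = j' ∨ j' + 1 = j))) :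
    ContainsInducedSubdivision house G := by
  obtain ⟨B, K, g, hK, hg, hr, ha⟩ := hℓ
  let F : ThetaVertex → V := fun v => Sum.elim (fun b => if b then y else x) (fun t => P t.1 t.2) v
  have hval : ∀ b, thetaValid ℓ (g b) := fun b => (hr _).2 ⟨b, rfl⟩
  have hF : ∀ a b, thetaValid ℓ a → thetaValid ℓ b →
      (F a = F b → a = b) ∧ (G.Adj (F a) (F b) ↔ thetaAdj ℓ a b) := by
    rintro ((_ | _) | ⟨i, j⟩) ((_ | _) | ⟨i', j'⟩) h1 h2 <;>
      simp only [thetaValid] at h1 h2 <;>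
      simp [F, thetaAdj]
    · exact ⟨hxy, hadj⟩
    · exact ⟨(hx _ _ h2).1.symm, (hx _ _ h2).2⟩
    · exact ⟨hxy.symm, by rw [G.adj_comm]; exact hadj⟩
    · exact ⟨(hy _ _ h2).1.symm, (hy _ _ h2).2⟩
    · exact ⟨(hx _ _ h1).1, by rw [G.adj_comm]; exact (hx _ _ h1).2⟩
    · exact ⟨(hy _ _ h1).1, by rw [G.adj_comm]; exact (hy _ _ h1).2⟩
    · exact hP _ _ h1 _ _ h2
  refine ⟨B, K, hK, ⟨⟨⟨F ∘ g, fun a b hab => hg ((hF _ _ (hval a) (hval b)).1 hab)⟩, ?_⟩⟩⟩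
  intro a b
  exact (hF _ _ (hval a) (hval b)).2.trans (ha a b).symm

lemma houseSubdividesToTheta_of_three_le_add {p q r : ℕ} (hp : 1 ≤ p) (hqr : 3 ≤ q + r) :
    HouseSubdividesToTheta ![p, q, r] := by
  have hswap : ∀ {a b c : ℕ}, HouseSubdividesToTheta ![a, b, c] →
      HouseSubdividesToTheta ![a, c, b] := by
    intro a b c h
    convert h.comp_perm (Equiv.swap 1 2) using 1
    funext i
    fin_cases i <;> simp [Equiv.swap_apply_def]
  have main : ∀ {q r : ℕ}, 3 ≤ q + r → q ≤ r → HouseSubdividesToTheta ![p, q, r] := by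
    intro q r hqr hle
    rcases Nat.eq_zero_or_pos q with rfl | hq
    · convert (houseSubdividesToTheta_of_le (p := 0) hp (by omega : 2 ≤ r)).comp_perm
        (Equiv.swap 0 1) using 1
      funext i
      fin_cases i <;> simp [Equiv.swap_apply_def]
    · exact houseSubdividesToTheta_of_le hq (by omega)
  rcases le_total q r with h | h
  · exact main hqr h
  · exact hswap (main (by omega) h)

section Holes

variable {V : Type} {G : SimpleGraph V}

/-- The vertices `p 0, …, p L` form an induced path of `G`, in this order. -/
def IsInducedPath (G : SimpleGraph V) (L : ℕ) (p : ℕ → V) : Prop :=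
  ∀ i ≤ L, ∀ j ≤ L, (p i = p j → i = j) ∧ (G.Adj (p i) (p j) ↔ i + 1 = j ∨ j + 1 = i)

/-- The vertices `c 0, …, c (n - 1)` form an induced cycle of length `n ≥ 5` of `G`,
in this order. -/
def IsLongHoleMap (G : SimpleGraph V) (n : ℕ) (c : ℕ → V) : Prop :=
  5 ≤ n ∧ ∀ i < n, ∀ j < n, (c i = c j → i = j) ∧
    (G.Adj (c i) (c j) ↔ i + 1 = j ∨ j + 1 = i ∨ (i = 0 ∧ j + 1 = n) ∨ (j = 0 ∧ i + 1 = n))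

/-- The set `H` induces a cycle of length at least `5` in `G`. -/
def IsLongHole (G : SimpleGraph V) (H : Set V) : Prop :=
  ∃ n c, IsLongHoleMap G n c ∧ ∀ v, v ∈ H ↔ ∃ i < n, c i = v

/-- The neighbours of `v` in `H` are `w` and the neighbours of `w`. -/
def IsTwinOn (G : SimpleGraph V) (H : Set V) (w v : V) : Prop :=
  ∀ h ∈ H, G.Adj v h ↔ h = w ∨ G.Adj w h

/-- Two adjacent vertices joined by two further paths, with at least one and at least two internal
vertices and no edge between the paths, give an induced subdivision of the house. -/
lemma house_of_unichord {x y : V} {L M : ℕ} {p q : ℕ → V} (hM : 1 ≤ M)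
    (hxy : G.Adj x y) (hp : IsInducedPath G L p) (hq : IsInducedPath G M q)
    (hpx : ∀ j ≤ L, p j ≠ x ∧ p j ≠ y ∧ (G.Adj x (p j) ↔ j = 0) ∧ (G.Adj y (p j) ↔ j = L))
    (hqx : ∀ j ≤ M, q j ≠ x ∧ q j ≠ y ∧ (G.Adj x (q j) ↔ j = 0) ∧ (G.Adj y (q j) ↔ j = M))
    (hpq : ∀ i ≤ L, ∀ j ≤ M, p i ≠ q j ∧ ¬ G.Adj (p i) (q j)) :
    ContainsInducedSubdivision house G := by
  refine containsInducedSubdivision_house_of_theta_s9 (x := x) (y := y) ![p, p, q]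
    (houseSubdividesToTheta_of_le (p := 0) (q := L + 1) (r := M + 1) (by omega) (by omega))
    hxy.ne ⟨fun _ => ⟨0, rfl⟩, fun _ => hxy⟩ ?_ ?_ ?_
  · simp only [Fin.forall_fin_succ]
    simp
    grind
  · simp only [Fin.forall_fin_succ]
    simp
    grind
  · simp only [Fin.forall_fin_succ]
    simp
    refine ⟨fun i hi => ⟨fun j hj => hp i hi j hj, fun j hj => hpq i hi j hj⟩,
      fun i hi => ⟨fun j hj => ?_, fun j hj => hq i hi j hj⟩⟩
    rw [G.adj_comm]
    exact ⟨(hpq j hj i hi).1.symm, (hpq j hj i hi).2⟩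

lemma IsLongHoleMap.house_of_path {n : ℕ} {c : ℕ → V} (hc : IsLongHoleMap G n c) {y : ℕ}
    (hy0 : 0 < y) (hyn : y < n) {L : ℕ} {p : ℕ → V} (hp : IsInducedPath G L p)
    (hpc : ∀ j ≤ L, ∀ i < n, p j ≠ c i ∧
      (G.Adj (p j) (c i) ↔ (j = 0 ∧ i = 0) ∨ (j = L ∧ i = y))) :
    ContainsInducedSubdivision house G := by
  obtain ⟨hn, hc⟩ := hc
  have hpc' : ∀ j ≤ L, ∀ i < n, c i ≠ p j ∧
      (G.Adj (c i) (p j) ↔ (j = 0 ∧ i = 0) ∨ (j = L ∧ i = y)) := fun j hj i hi => by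
    rw [G.adj_comm]
    exact ⟨(hpc j hj i hi).1.symm, (hpc j hj i hi).2⟩
  have hlast : ∀ j, j < n - y - 1 → n - 1 - j < n := fun j hj => by omega
  refine containsInducedSubdivision_house_of_theta_s9 (x := c 0) (y := c y)
    ![p, fun j => c (j + 1), fun j => c (n - 1 - j)]
    (houseSubdividesToTheta_of_three_le_add (p := L + 1) (q := y - 1) (r := n - y - 1)
      (by omega) (by omega))
    ?_ ?_ ?_ ?_ ?_
  · intro h
    have := (hc 0 (by omega) y hyn).1 h
    omega
  · rw [(hc 0 (by omega) y hyn).2]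
    simp only [Fin.exists_fin_succ]
    simp
    omega
  · simp only [Fin.forall_fin_succ]
    simp
    refine ⟨fun j hj => ?_, fun j hj => ?_, fun j hj => ?_⟩
    · have := hpc j hj 0 (by omega)
      rw [G.adj_comm, this.2]
      exact ⟨this.1, by omega⟩
    · have := hc (j + 1) (by omega) 0 (by omega)
      rw [G.adj_comm, this.2]
      exact ⟨fun h => by have := this.1 h; omega, by omega⟩
    · have := hc (n - 1 - j) (by omega) 0 (by omega)
      rw [G.adj_comm, this.2]
      exact ⟨fun h => by have := this.1 h; omega, by omega⟩
  · simp only [Fin.forall_fin_succ]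
    simp
    refine ⟨fun j hj => ?_, fun j hj => ?_, fun j hj => ?_⟩
    · have := hpc j hj y hyn
      rw [G.adj_comm, this.2]
      exact ⟨this.1, by omega⟩
    · have := hc (j + 1) (by omega) y hyn
      rw [G.adj_comm, this.2]
      exact ⟨fun h => by have := this.1 h; omega, by omega⟩
    · have := hc (n - 1 - j) (by omega) y hyn
      rw [G.adj_comm, this.2]
      exact ⟨fun h => by have := this.1 h; omega, by omega⟩
  · simp only [Fin.forall_fin_succ]
    simp
    refine ⟨fun i hi => ⟨fun j hj => hp i hi j hj, fun j hj => ?_, fun j hj => ?_⟩,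
      fun i hi => ⟨fun j hj => ?_, fun j hj => ?_, fun j hj => ?_⟩,
      fun i hi => ⟨fun j hj => ?_, fun j hj => ?_, fun j hj => ?_⟩⟩
    · have := hpc i hi (j + 1) (by omega)
      rw [this.2]
      exact ⟨this.1, by omega⟩
    · have := hpc i hi (n - 1 - j) (by omega)
      rw [this.2]
      exact ⟨this.1, by omega⟩
    · have := hpc' j hj (i + 1) (by omega)
      rw [this.2]
      exact ⟨this.1, by omega⟩
    · have := hc (i + 1) (by omega) (j + 1) (by omega)
      rw [this.2]
      exact ⟨fun h => by have := this.1 h; omega, by omega⟩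
    · have := hc (i + 1) (by omega) (n - 1 - j) (by omega)
      rw [this.2]
      exact ⟨fun h => by have := this.1 h; omega, by omega⟩
    · have := hpc' j hj (n - 1 - i) (by omega)
      rw [this.2]
      exact ⟨this.1, by omega⟩
    · have := hc (n - 1 - i) (by omega) (j + 1) (by omega)
      rw [this.2]
      exact ⟨fun h => by have := this.1 h; omega, by omega⟩
    · have := hc (n - 1 - i) (by omega) (n - 1 - j) (by omega)
      rw [this.2]
      exact ⟨fun h => by have := this.1 h; omega, by omega⟩

lemma IsLongHoleMap.rotate {n : ℕ} {c : ℕ → V} (hc : IsLongHoleMap G n c) {k : ℕ} (hk : k < n) :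
    IsLongHoleMap G n (fun i => c (if i + k < n then i + k else i + k - n)) := by
  refine ⟨hc.1, fun i hi j hj => ?_⟩
  have := hc.2 (if i + k < n then i + k else i + k - n) (by split_ifs <;> omega)
    (if j + k < n then j + k else j + k - n) (by split_ifs <;> omega)
  refine ⟨fun h => ?_, this.2.trans ?_⟩
  · have := this.1 h
    split_ifs at this <;> omega
  · split_ifs <;> omega

lemma IsLongHole.exists_map_zero {H : Set V} (hH : IsLongHole G H) {x : V} (hx : x ∈ H) :
    ∃ n c, IsLongHoleMap G n c ∧ (∀ v, v ∈ H ↔ ∃ i < n, c i = v) ∧ c 0 = x := by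
  obtain ⟨n, c, hc, hr⟩ := hH
  obtain ⟨k, hk, rfl⟩ := (hr x).1 hx
  refine ⟨n, _, hc.rotate hk, fun v => (hr v).trans ⟨?_, ?_⟩, by simp [hk]⟩
  · rintro ⟨i, hi, rfl⟩
    refine ⟨if k ≤ i then i - k else i + n - k, by split_ifs <;> omega, ?_⟩
    congr 1
    split_ifs <;> omega
  · rintro ⟨i, hi, rfl⟩
    exact ⟨_, by split_ifs <;> omega, rfl⟩

/-- A long hole together with a path outside it joining two of its vertices, without further edges,
contains an induced subdivision of the house. -/
lemma IsLongHole.house_of_path {H : Set V} (hH : IsLongHole G H) {x y : V} (hx : x ∈ H)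
    (hy : y ∈ H) (hxy : x ≠ y) {L : ℕ} {p : ℕ → V} (hp : IsInducedPath G L p)
    (hpH : ∀ j ≤ L, p j ∉ H)
    (hadj : ∀ j ≤ L, ∀ h ∈ H, G.Adj (p j) h ↔ (j = 0 ∧ h = x) ∨ (j = L ∧ h = y)) :
    ContainsInducedSubdivision house G := by
  obtain ⟨n, c, hc, hr, rfl⟩ := hH.exists_map_zero hx
  obtain ⟨k, hk, rfl⟩ := (hr y).1 hy
  have hn := hc.1
  have hinj : ∀ i < n, ∀ j < n, c i = c j ↔ i = j := fun i hi j hj =>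
    ⟨(hc.2 i hi j hj).1, fun h => h ▸ rfl⟩
  refine hc.house_of_path (y := k) (Nat.pos_of_ne_zero fun h => hxy (h ▸ rfl)) hk hp
    fun j hj i hi => ⟨fun h => hpH j hj (h ▸ (hr _).2 ⟨i, hi, rfl⟩), ?_⟩
  rw [hadj j hj _ ((hr _).2 ⟨i, hi, rfl⟩), hinj i hi 0 (by omega), hinj i hi k hk]

/-- Replacing a vertex of a long hole by a twin gives a long hole. -/
lemma IsLongHole.replace {H : Set V} (hH : IsLongHole G H) {w v : V} (hw : w ∈ H) (hv : v ∉ H)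
    (htw : IsTwinOn G H w v) : IsLongHole G (insert v (H \ {w})) := by
  obtain ⟨n, c, hc, hr, rfl⟩ := hH.exists_map_zero hw
  have hmem : ∀ i < n, c i ∈ H := fun i hi => (hr _).2 ⟨i, hi, rfl⟩
  have hn := hc.1
  have hvc : ∀ i < n, c i ≠ v := fun i hi h => hv (h ▸ hmem i hi)
  have hadj : ∀ i < n, i ≠ 0 → (G.Adj v (c i) ↔ G.Adj (c 0) (c i)) := fun i hi h0 => by
    rw [htw _ (hmem i hi), or_iff_right]
    intro h
    exact h0 ((hc.2 i hi 0 (by omega)).1 h)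
  refine ⟨n, fun i => if i = 0 then v else c i, ⟨hn, fun i hi j hj => ?_⟩, fun u => ?_⟩
  · have h1 := hc.2 i hi j hj
    by_cases hi0 : i = 0 <;> by_cases hj0 : j = 0
    · subst hi0 hj0
      simp
      omega
    · subst hi0
      simp only [if_true, hj0, if_false]
      exact ⟨fun h => absurd h.symm (hvc j hj), by rw [hadj j hj hj0, h1.2]; simp; omega⟩
    · subst hj0
      simp only [if_true, hi0, if_false]
      exact ⟨fun h => absurd h (hvc i hi), by
        rw [G.adj_comm, hadj i hi hi0, G.adj_comm, h1.2]; simp; omega⟩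
    · simpa [hi0, hj0] using h1
  · simp only [Set.mem_insert_iff, Set.mem_sdiff, Set.mem_singleton_iff, hr]
    constructor
    · rintro (rfl | ⟨⟨i, hi, rfl⟩, h0⟩)
      · exact ⟨0, by omega, by simp⟩
      · exact ⟨i, hi, if_neg (by rintro rfl; exact h0 rfl)⟩
    · rintro ⟨i, hi, rfl⟩
      by_cases hi0 : i = 0
      · simp [hi0]
      · simp only [hi0, if_false]
        exact Or.inr ⟨⟨i, hi, rfl⟩, fun h => hi0 ((hc.2 i hi 0 (by omega)).1 h)⟩

end Holes

section Holes

variable {V : Type} {G : SimpleGraph V}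

lemma IsLongHoleMap.neighbors_of_adj_zero {n : ℕ} {c : ℕ → V} (hc : IsLongHoleMap G n c) {v : V}
    (hG : ¬ ContainsInducedSubdivision house G) (hv : ∀ i < n, v ≠ c i)
    (h0 : G.Adj v (c 0)) (h1 : ¬ G.Adj v (c 1)) :
    (∀ i < n, G.Adj v (c i) ↔ i = 0) ∨
      ∀ i < n, G.Adj v (c i) ↔ i = 0 ∨ i + 1 = n ∨ i + 2 = n := by
  classical
  have hn := hc.1
  by_cases hd : ∃ d, 0 < d ∧ d < n ∧ G.Adj v (c d)
  swap
  · push Not at hd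
    left
    intro i hi
    refine ⟨fun h => ?_, fun h => h ▸ h0⟩
    by_contra h'
    exact hd i (by omega) hi h
  obtain ⟨d, ⟨hd0, hdn, hd⟩, hmin⟩ : ∃ d, (0 < d ∧ d < n ∧ G.Adj v (c d)) ∧
      ∀ j, 0 < j → j < d → ¬ G.Adj v (c j) :=
    ⟨Nat.find hd, Nat.find_spec hd, fun j hj hjd h =>
      Nat.find_min hd hjd ⟨hj, hjd.trans (Nat.find_spec hd).2.1, h⟩⟩
  have hd1 : d ≠ 1 := by rintro rfl; exact h1 hd
  by_cases he : ∃ e, d < e ∧ e < n ∧ G.Adj v (c e)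
  swap
  · exfalso
    push Not at he
    refine hG (hc.house_of_path (L := 0) (p := fun _ => v) hd0 hdn ?_ ?_)
    · intro i hi j hj
      simp
      omega
    · intro j hj i hi
      refine ⟨hv i hi, ?_⟩
      rcases Nat.eq_zero_or_pos i with rfl | hi0
      · simp [h0]; omega
      · rcases lt_trichotomy i d with h | rfl | h
        · simp [hmin i hi0 h]; omega
        · simp [hd]; omega
        · simp [he i h hi]; omega
  obtain ⟨e, ⟨hde, hen, he⟩, hmin'⟩ : ∃ e, (d < e ∧ e < n ∧ G.Adj v (c e)) ∧
      ∀ j, d < j → j < e → ¬ G.Adj v (c j) :=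
    ⟨Nat.find he, Nat.find_spec he, fun j hj hje h =>
      Nat.find_min he hje ⟨hj, hje.trans (Nat.find_spec he).2.1, h⟩⟩
  have hadj : ∀ i ≤ e, (G.Adj v (c i) ↔ i = 0 ∨ i = d ∨ i = e) := by
    intro i hi
    rcases Nat.eq_zero_or_pos i with rfl | hi0
    · simp [h0]
    · rcases lt_trichotomy i d with h | rfl | h
      · simp [hmin i hi0 h]; omega
      · simp [hd]
      · rcases lt_or_eq_of_le hi with h' | rfl
        · simp [hmin' i h h']; omega
        · simp [he]
  rcases lt_or_ge (e + 1) n with hlt | hge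
  · exfalso
    refine hG (house_of_unichord (x := v) (y := c d) (L := e - d - 1) (M := d - 1)
      (p := fun j => c (e - j)) (q := fun j => c j) (by omega) hd ?_ ?_ ?_ ?_ ?_)
    · intro i hi j hj
      have := hc.2 (e - i) (by omega) (e - j) (by omega)
      refine ⟨fun h => by have := this.1 h; omega, by rw [this.2]; omega⟩
    · intro i hi j hj
      have := hc.2 i (by omega) j (by omega)
      refine ⟨this.1, by rw [this.2]; omega⟩
    · intro j hj
      have := hc.2 d (by omega) (e - j) (by omega)
      refine ⟨(hv _ (by omega)).symm, fun h => by have := this.1 h.symm; omega, ?_, ?_⟩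
      · rw [hadj _ (by omega)]; omega
      · rw [this.2]; omega
    · intro j hj
      have := hc.2 d (by omega) j (by omega)
      refine ⟨(hv _ (by omega)).symm, fun h => by have := this.1 h.symm; omega, ?_, ?_⟩
      · rw [hadj _ (by omega)]; omega
      · rw [this.2]; omega
    · intro i hi j hj
      have := hc.2 (e - i) (by omega) j (by omega)
      exact ⟨fun h => by have := this.1 h; omega, by rw [this.2]; omega⟩
  · rcases eq_or_ne (d + 2) n with heq | hne
    · right
      intro i hi
      rw [hadj i (by omega)]
      omega
    · exfalso
      refine hG (house_of_unichord (x := v) (y := c 0) (L := 0) (M := d - 1)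
        (p := fun _ => c e) (q := fun j => c (d - j)) (by omega) h0 ?_ ?_ ?_ ?_ ?_)
      · intro i hi j hj
        simp
        omega
      · intro i hi j hj
        have := hc.2 (d - i) (by omega) (d - j) (by omega)
        refine ⟨fun h => by have := this.1 h; omega, by rw [this.2]; omega⟩
      · intro j hj
        have := hc.2 0 (by omega) e (by omega)
        refine ⟨(hv _ (by omega)).symm, fun h => by have := this.1 h.symm; omega, ?_, ?_⟩
        · rw [hadj _ (by omega)]; omega
        · rw [this.2]; omega
      · intro j hj
        have := hc.2 0 (by omega) (d - j) (by omega)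
        refine ⟨(hv _ (by omega)).symm, fun h => by have := this.1 h.symm; omega, ?_, ?_⟩
        · rw [hadj _ (by omega)]; omega
        · rw [this.2]; omega
      · intro i hi j hj
        have := hc.2 e (by omega) (d - j) (by omega)
        exact ⟨fun h => by have := this.1 h; omega, by rw [this.2]; omega⟩

/-- In a graph without induced subdivisions of the house, a vertex outside a long hole is adjacent
to all, none or one of its vertices, or to a vertex and its two neighbours. -/
lemma IsLongHole.neighbors {H : Set V} (hH : IsLongHole G H)
    (hG : ¬ ContainsInducedSubdivision house G) {v : V} (hv : v ∉ H) :
    (∀ h ∈ H, G.Adj v h) ∨ (∀ h ∈ H, ¬ G.Adj v h) ∨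
      (∃ w ∈ H, ∀ h ∈ H, G.Adj v h ↔ h = w) ∨ ∃ w ∈ H, IsTwinOn G H w v := by
  classical
  by_cases hall : ∀ h ∈ H, G.Adj v h
  · exact Or.inl hall
  by_cases hnone : ∀ h ∈ H, ¬ G.Adj v h
  · exact Or.inr (Or.inl hnone)
  push Not at hall hnone
  obtain ⟨x, hx, hvx⟩ := hnone
  obtain ⟨y, hy, hvy⟩ := hall
  obtain ⟨n, c, hc, hr, rfl⟩ := hH.exists_map_zero hx
  have hn := hc.1
  obtain ⟨k, hk, rfl⟩ := (hr y).1 hy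
  have hex : ∃ j, ¬ G.Adj v (c j) := ⟨k, hvy⟩
  have hle : Nat.find hex ≤ k := Nat.find_min' hex hvy
  have hpos : Nat.find hex ≠ 0 := fun h => by
    have := Nat.find_spec hex
    rw [h] at this
    exact this hvx
  obtain ⟨j, hj⟩ := Nat.exists_eq_succ_of_ne_zero hpos
  have hj1 : ¬ G.Adj v (c (j + 1)) := by
    have := Nat.find_spec hex
    rwa [hj] at this
  have hj0 : G.Adj v (c j) := by
    by_contra h
    have := Nat.find_min' hex h
    omega
  have hjn : j + 1 < n := by omega
  have hmem : ∀ i < n, c i ∈ H := fun i hi => (hr _).2 ⟨i, hi, rfl⟩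
  have hc' := hc.rotate (k := j) (by omega)
  have hr' : ∀ h ∈ H, ∃ i < n, (fun i => c (if i + j < n then i + j else i + j - n)) i = h := by
    intro h hh
    obtain ⟨i, hi, rfl⟩ := (hr h).1 hh
    refine ⟨if j ≤ i then i - j else i + n - j, by split_ifs <;> omega, ?_⟩
    dsimp only
    congr 1
    split_ifs <;> omega
  have hmem' : ∀ i < n, (fun i => c (if i + j < n then i + j else i + j - n)) i ∈ H := by
    intro i hi
    exact hmem _ (by split_ifs <;> omega)
  have h0' : G.Adj v ((fun i => c (if i + j < n then i + j else i + j - n)) 0) := by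
    simp [show j < n by omega, hj0]
  have h1' : ¬ G.Adj v ((fun i => c (if i + j < n then i + j else i + j - n)) 1) := by
    simpa [hjn, add_comm 1 j] using hj1
  generalize (fun i => c (if i + j < n then i + j else i + j - n)) = c' at *
  have hv' : ∀ i < n, v ≠ c' i := fun i hi h => hv (h ▸ hmem' i hi)
  have hinj : ∀ i < n, ∀ j < n, c' i = c' j ↔ i = j := fun i hi j hj =>
    ⟨(hc'.2 i hi j hj).1, fun h => h ▸ rfl⟩
  right; right
  rcases hc'.neighbors_of_adj_zero hG hv' h0' h1' with h | h
  · left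
    refine ⟨c' 0, hmem' 0 (by omega), fun u hu => ?_⟩
    obtain ⟨i, hi, rfl⟩ := hr' u hu
    rw [h i hi, hinj i hi 0 (by omega)]
  · right
    refine ⟨c' (n - 1), hmem' _ (by omega), fun u hu => ?_⟩
    obtain ⟨i, hi, rfl⟩ := hr' u hu
    rw [h i hi, hinj i hi _ (by omega), (hc'.2 _ (by omega) i hi).2]
    omega

lemma IsLongHole.finite {H : Set V} (hH : IsLongHole G H) : H.Finite := by
  obtain ⟨n, c, -, hr⟩ := hH
  refine ((Set.finite_Iio n).image c).subset fun v hv => ?_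
  obtain ⟨i, hi, rfl⟩ := (hr v).1 hv
  exact ⟨i, hi, rfl⟩

lemma IsLongHole.five_le_ncard {H : Set V} (hH : IsLongHole G H) : 5 ≤ H.ncard := by
  obtain ⟨n, c, hc, hr⟩ := hH
  have : H = c '' Set.Iio n := by
    ext v
    simp [hr]
  have hinj : Set.InjOn c (Set.Iio n) := fun i hi j hj h => (hc.2 i hi j hj).1 h
  rw [this, hinj.ncard_image]
  simpa [Set.ncard_eq_toFinset_card'] using hc.1

lemma IsLongHole.ncard_neighbors_self {H : Set V} (hH : IsLongHole G H) {w : V} (hw : w ∈ H) :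
    {h ∈ H | h = w ∨ G.Adj w h}.ncard = 3 := by
  obtain ⟨n, c, hc, hr, rfl⟩ := hH.exists_map_zero hw
  have hn := hc.1
  have hinj : ∀ i < n, ∀ j < n, i ≠ j → c i ≠ c j := fun i hi j hj h h' =>
    h ((hc.2 i hi j hj).1 h')
  rw [Set.ncard_eq_three]
  refine ⟨c 0, c 1, c (n - 1), hinj _ (by omega) _ (by omega) (by omega),
    hinj _ (by omega) _ (by omega) (by omega), hinj _ (by omega) _ (by omega) (by omega), ?_⟩
  ext v
  simp only [Set.mem_ofPred_eq, Set.mem_insert_iff, Set.mem_singleton_iff]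
  constructor
  · rintro ⟨hv, h⟩
    obtain ⟨i, hi, rfl⟩ := (hr v).1 hv
    rw [(hc.2 0 (by omega) i hi).2] at h
    rcases h with h | h
    · exact Or.inl h
    · have : i = 1 ∨ i = n - 1 := by omega
      rcases this with rfl | rfl <;> simp
  · rintro (rfl | rfl | rfl)
    · exact ⟨hw, Or.inl rfl⟩
    · exact ⟨(hr _).2 ⟨1, by omega, rfl⟩, Or.inr ((hc.2 0 (by omega) 1 (by omega)).2.2 (by omega))⟩
    · exact ⟨(hr _).2 ⟨n - 1, by omega, rfl⟩,
        Or.inr ((hc.2 0 (by omega) (n - 1) (by omega)).2.2 (by omega))⟩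

lemma IsLongHole.ncard_neighbors {H : Set V} (hH : IsLongHole G H)
    (hG : ¬ ContainsInducedSubdivision house G) {v : V} (hv : v ∉ H) :
    ((∀ h ∈ H, G.Adj v h) ∧ 5 ≤ {h ∈ H | G.Adj v h}.ncard) ∨
      {h ∈ H | G.Adj v h}.ncard = 0 ∨ {h ∈ H | G.Adj v h}.ncard = 1 ∨
      {h ∈ H | G.Adj v h}.ncard = 3 := by
  rcases hH.neighbors hG hv with h | h | ⟨w, hw, h⟩ | ⟨w, hw, h⟩
  · left
    refine ⟨h, ?_⟩
    rw [Set.sep_eq_self_iff_mem_true.2 h]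
    exact hH.five_le_ncard
  · right; left
    rw [Set.sep_eq_empty_iff_mem_false.2 h, Set.ncard_empty]
  · right; right; left
    rw [Set.ncard_eq_one]
    refine ⟨w, ?_⟩
    ext u
    simp only [Set.mem_ofPred_eq, Set.mem_singleton_iff]
    exact ⟨fun hu => (h u hu.1).1 hu.2, fun hu => hu ▸ ⟨hw, (h w hw).2 rfl⟩⟩
  · right; right; right
    rw [← hH.ncard_neighbors_self hw]
    congr 1
    ext u
    simp only [Set.mem_ofPred_eq]
    exact and_congr_right fun hu => h u hu

/-- If `s` is a twin of a vertex `x` of a long hole, then an outside vertex adjacent to `s`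
but not to `x` has no neighbour in the hole. -/
lemma IsLongHole.not_adj_of_adj_twin {H : Set V} (hH : IsLongHole G H)
    (hG : ¬ ContainsInducedSubdivision house G) {x s v : V} (hx : x ∈ H) (hs : s ∉ H)
    (htw : IsTwinOn G H x s) (hv : v ∉ H) (hvs : G.Adj v s) (hvx : ¬ G.Adj v x) :
    ∀ h ∈ H, ¬ G.Adj v h := by
  have hH' := hH.replace hx hs htw
  have hv' : v ∉ insert s (H \ {x}) := by
    rintro (h | h)
    · exact hvs.ne h
    · exact hv h.1
  have hfin : {h ∈ H | G.Adj v h}.Finite := hH.finite.subset fun _ h => h.1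
  have heq : {h ∈ insert s (H \ {x}) | G.Adj v h} = insert s {h ∈ H | G.Adj v h} := by
    ext u
    simp only [Set.mem_ofPred_eq, Set.mem_insert_iff, Set.mem_sdiff, Set.mem_singleton_iff]
    constructor
    · rintro ⟨h | h, h'⟩
      · exact Or.inl h
      · exact Or.inr ⟨h.1, h'⟩
    · rintro (rfl | ⟨h, h'⟩)
      · exact ⟨Or.inl rfl, hvs⟩
      · exact ⟨Or.inr ⟨h, fun hux => hvx (hux ▸ h')⟩, h'⟩
  have h1 := hH.ncard_neighbors hG hv
  have h2 := hH'.ncard_neighbors hG hv'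
  rw [heq, Set.ncard_insert_of_notMem (fun h => hs h.1) hfin] at h2
  have h0 : {h ∈ H | G.Adj v h}.ncard = 0 := by
    rcases h1 with h1 | h1
    · exact absurd (h1.1 x hx) hvx
    · omega
  rw [Set.ncard_eq_zero hfin] at h0
  exact Set.sep_eq_empty_iff_mem_false.1 h0

end Holes

section Reach

variable {V : Type} {G : SimpleGraph V}

/-- `u` and `v` are adjacent and both lie in `E`. -/
def StepIn (G : SimpleGraph V) (E : Set V) (u v : V) : Prop := G.Adj u v ∧ u ∈ E ∧ v ∈ E

/-- `v` can be reached from `u` by a walk inside `E`. -/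
def Reach (G : SimpleGraph V) (E : Set V) : V → V → Prop := Relation.ReflTransGen (StepIn G E)

lemma Reach.symm {E : Set V} {u v : V} (h : Reach G E u v) : Reach G E v u := by
  induction h with
  | refl => exact Relation.ReflTransGen.refl
  | tail _ h ih => exact Relation.ReflTransGen.head ⟨h.1.symm, h.2.2, h.2.1⟩ ih

lemma Reach.trans {E : Set V} {u v w : V} (h : Reach G E u v) (h' : Reach G E v w) :
    Reach G E u w := Relation.ReflTransGen.trans h h'

lemma Reach.mono {E F : Set V} (hEF : E ⊆ F) {u v : V} (h : Reach G E u v) : Reach G F u v := by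
  induction h with
  | refl => exact Relation.ReflTransGen.refl
  | tail _ h ih => exact Relation.ReflTransGen.tail ih ⟨h.1, hEF h.2.1, hEF h.2.2⟩

lemma Reach.of_adj {E : Set V} {u v : V} (h : G.Adj u v) (hu : u ∈ E) (hv : v ∈ E) :
    Reach G E u v := Relation.ReflTransGen.single ⟨h, hu, hv⟩

lemma Reach.exists_exit {E P : Set V} {u w : V} (h : Reach G E u w) (hu : u ∈ P) (hw : w ∉ P) :
    ∃ r' r, Reach G (E ∩ P) u r' ∧ r' ∈ P ∧ r ∉ P ∧ StepIn G E r' r := by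
  revert hu
  induction h using Relation.ReflTransGen.head_induction_on with
  | refl => exact fun hu => absurd hu hw
  | @head a b hab _ ih =>
    intro ha
    by_cases hb : b ∈ P
    · obtain ⟨r', r, hr, h⟩ := ih hb
      exact ⟨r', r, Relation.ReflTransGen.head ⟨hab.1, ⟨hab.2.1, ha⟩, ⟨hab.2.2, hb⟩⟩ hr, h⟩
    · exact ⟨a, b, Relation.ReflTransGen.refl, ha, hb, hab⟩

lemma Reach.exists_inducedPath {E : Set V} {X Y : V → Prop} {u w : V} (h : Reach G E u w)
    (hu : u ∈ E) (hX : X u) (hY : Y w) :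
    ∃ L p, X (p 0) ∧ Y (p L) ∧ (∀ i ≤ L, p i ∈ E) ∧ IsInducedPath G L p ∧
      (∀ i ≤ L, X (p i) → i = 0) ∧ ∀ i ≤ L, Y (p i) → i = L := by
  classical
  have hex : ∃ L, ∃ p : ℕ → V, X (p 0) ∧ Y (p L) ∧ (∀ i ≤ L, p i ∈ E) ∧
      ∀ i < L, G.Adj (p i) (p (i + 1)) := by
    have : ∃ L, ∃ p : ℕ → V, p 0 = u ∧ p L = w ∧ (∀ i ≤ L, p i ∈ E) ∧
        ∀ i < L, G.Adj (p i) (p (i + 1)) := by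
      clear hX hY
      induction h with
      | refl => exact ⟨0, fun _ => u, rfl, rfl, fun _ _ => hu, fun i hi => by omega⟩
      | @tail b c hb hbc ih =>
        obtain ⟨L, p, h0, hL, hE, ha⟩ := ih
        refine ⟨L + 1, fun i => if i ≤ L then p i else c, by simp [h0], by simp, ?_, ?_⟩
        · intro i hi
          dsimp only
          split_ifs with h
          · exact hE i h
          · exact hbc.2.2
        · intro i hi
          rcases Nat.lt_succ_iff_lt_or_eq.1 hi with h | rfl
          · simpa [h.le, Nat.succ_le_of_lt h] using ha i h
          · simpa [hL] using hbc.1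
    obtain ⟨L, p, h0, hL, h⟩ := this
    exact ⟨L, p, h0 ▸ hX, hL ▸ hY, h⟩
  obtain ⟨L, ⟨p, h0, hL, hE, ha⟩, hmin⟩ : ∃ L, (∃ p : ℕ → V, X (p 0) ∧ Y (p L) ∧
      (∀ i ≤ L, p i ∈ E) ∧ ∀ i < L, G.Adj (p i) (p (i + 1))) ∧
      ∀ M < L, ¬ ∃ p : ℕ → V, X (p 0) ∧ Y (p M) ∧ (∀ i ≤ M, p i ∈ E) ∧
        ∀ i < M, G.Adj (p i) (p (i + 1)) :=
    ⟨Nat.find hex, Nat.find_spec hex, fun M hM => Nat.find_min hex hM⟩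
  have hYi : ∀ i ≤ L, Y (p i) → i = L := by
    intro i hi hYi
    by_contra hne
    exact hmin i (by omega) ⟨p, h0, hYi, fun k hk => hE k (by omega), fun k hk => ha k (by omega)⟩
  have hXi : ∀ i ≤ L, X (p i) → i = 0 := by
    intro i hi hXi
    by_contra hne
    refine hmin (L - i) (by omega) ⟨fun k => p (k + i), by simpa using hXi, ?_,
      fun k hk => hE _ (by omega), fun k hk => ?_⟩
    · simpa [Nat.sub_add_cancel hi] using hL
    · simpa [add_right_comm] using ha (k + i) (by omega)
  have hshort : ∀ i j, i + 1 < j → j ≤ L → ¬ G.Adj (p i) (p j) := by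
    intro i j hij hj hadj
    refine hmin (L - (j - i - 1)) (by omega)
      ⟨fun k => if k ≤ i then p k else p (k + (j - i - 1)), by simpa using h0, ?_, ?_, ?_⟩
    · dsimp only
      rw [if_neg (by omega), Nat.sub_add_cancel (by omega)]
      exact hL
    · intro k hk
      dsimp only
      split_ifs
      · exact hE _ (by omega)
      · exact hE _ (by omega)
    · intro k hk
      dsimp only
      rcases lt_trichotomy k i with h | rfl | h
      · rw [if_pos h.le, if_pos (by omega)]
        exact ha k (by omega)
      · rw [if_pos le_rfl, if_neg (by omega), show k + 1 + (j - k - 1) = j by omega]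
        exact hadj
      · rw [if_neg (by omega), if_neg (by omega), add_right_comm]
        exact ha _ (by omega)
  have hne : ∀ i j, i < j → j ≤ L → p i ≠ p j := by
    intro i j hij hj h
    rcases eq_or_lt_of_le hj with rfl | hj'
    · have := hYi i (by omega) (h ▸ hL)
      omega
    · exact hshort i (j + 1) (by omega) hj' (h ▸ ha j hj')
  refine ⟨L, p, h0, hL, hE, fun i hi j hj => ⟨fun h => ?_, fun h => ?_, fun h => ?_⟩, hXi, hYi⟩
  · rcases lt_trichotomy i j with h' | h' | h'
    · exact absurd h (hne i j h' hj)
    · exact h'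
    · exact absurd h.symm (hne j i h' hi)
  · by_contra h'
    rcases lt_trichotomy i j with h'' | rfl | h''
    · exact hshort i j (by omega) hj h
    · exact h.ne rfl
    · exact hshort j i (by omega) hi h.symm
  · rcases h with rfl | rfl
    · exact ha i (by omega)
    · exact (ha j (by omega)).symm

/-- A connection outside a long hole, from a vertex attaching only at `x` to another part of the
hole, produces an induced subdivision of the house. -/
lemma IsLongHole.false_of_reach {H : Set V} (hH : IsLongHole G H)
    (hG : ¬ ContainsInducedSubdivision house G) {E : Set V} {x t h : V} (hx : x ∈ H) (ht : t ∉ H)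
    (htN : ∀ h ∈ H, G.Adj t h ↔ h = x) (hxE : x ∉ E) (htE : t ∈ E) (hh : h ∈ H)
    (hth : Reach G E t h)
    (hE : ∀ v ∈ E, v ∉ H → (∃ h ∈ H, ¬ G.Adj v h) ∧ ¬ IsTwinOn G H x v) : False := by
  obtain ⟨r', r, hr, hr'H, hrH, hadj, hr'E, hrE⟩ :=
    hth.exists_exit (P := Hᶜ) ht (fun h' => h' hh)
  have hrH : r ∈ H := not_not.1 hrH
  obtain ⟨L, p, hX, ⟨y, hy, hyx, hyL⟩, hpE, hp, hpX, hpY⟩ := hr.exists_inducedPath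
    (X := fun v => ∀ h ∈ H, G.Adj v h ↔ h = x) (Y := fun v => ∃ h ∈ H, h ≠ x ∧ G.Adj v h)
    ⟨htE, ht⟩ htN ⟨r, hrH, fun h => hxE (h ▸ hrE), hadj⟩
  have hL : L ≠ 0 := by
    rintro rfl
    exact hyx ((hX y hy).1 hyL)
  have hlow : ∀ j < L, ∀ h ∈ H, G.Adj (p j) h ↔ j = 0 ∧ h = x := by
    intro j hj h hh
    rcases Nat.eq_zero_or_pos j with rfl | hj0
    · simp [hX h hh]
    · have hnY : ∀ h ∈ H, G.Adj (p j) h → h = x := by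
        intro h hh ha
        by_contra hne
        have := hpY j hj.le ⟨h, hh, hne, ha⟩
        omega
      have hnX : ¬ G.Adj (p j) x := by
        intro ha
        have := hpX j hj.le fun h hh => ⟨hnY h hh, fun h => h ▸ ha⟩
        omega
      exact ⟨fun ha => absurd (hnY h hh ha ▸ ha) hnX, fun h => absurd h.1 hj0.ne'⟩
  have hpH : ∀ j ≤ L, p j ∉ H := fun j hj => (hpE j hj).2
  obtain ⟨⟨z, hz, hzL⟩, htw⟩ := hE _ (hpE L le_rfl).1 (hpH L le_rfl)
  rcases hH.neighbors hG (hpH L le_rfl) with h1 | h1 | ⟨w, hw, h1⟩ | ⟨w, hw, h1⟩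
  · exact hzL (h1 z hz)
  · exact h1 y hy hyL
  · have hwy := (h1 y hy).1 hyL
    subst hwy
    refine hG (hH.house_of_path hx hy hyx.symm hp hpH fun j hj h hh => ?_)
    rcases lt_or_eq_of_le hj with hj | rfl
    · rw [hlow j hj h hh]
      exact ⟨Or.inl, fun h' => h'.resolve_right fun h'' => hj.ne h''.1⟩
    · rw [h1 h hh]
      exact ⟨fun h' => Or.inr ⟨rfl, h'⟩, fun h' => (h'.resolve_left fun h'' => hL h''.1).2⟩
  · have hwx : x ≠ w := by
      rintro rfl
      exact htw h1
    have hpw : ∀ j < L, p j ≠ p L := fun j hj h => hj.ne ((hp j hj.le L le_rfl).1 h)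
    refine hG ((hH.replace hw (hpH L le_rfl) h1).house_of_path (x := x) (y := p L) (L := L - 1)
      (Or.inr ⟨hx, hwx⟩) (Or.inl rfl) (fun h => hpH L le_rfl (h ▸ hx))
      (fun i hi j hj => hp i (by omega) j (by omega)) ?_ ?_)
    · rintro j hj (h | h)
      · exact hpw j (by omega) h
      · exact hpH j (by omega) h.1
    · rintro j hj h (rfl | ⟨hh, -⟩)
      · rw [(hp j (by omega) L le_rfl).2]
        have : p L ≠ x := fun h => hpH L le_rfl (h ▸ hx)
        simp only [this, and_false, and_true, false_or]
        omega
      · rw [hlow j (by omega) h hh]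
        have : h ≠ p L := fun h' => hpH L le_rfl (h' ▸ hh)
        simp [this]

end Reach

section Frame

variable {V : Type} {G : SimpleGraph V}

lemma IsLongHole.exists_adj {H : Set V} (hH : IsLongHole G H) {x : V} (hx : x ∈ H) :
    ∃ h ∈ H, G.Adj x h := by
  obtain ⟨n, c, hc, hr, rfl⟩ := hH.exists_map_zero hx
  have := hc.1
  exact ⟨c 1, (hr _).2 ⟨1, by omega, rfl⟩, (hc.2 0 (by omega) 1 (by omega)).2.2 (by omega)⟩

/-- `A` and `B` are disjoint connected sets without edges between them, and `H` is a long hole in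
`A ∪ B ∪ S` meeting both sides, each of whose vertices in `S` has hole neighbours on both sides. -/
structure IsFrame (G : SimpleGraph V) (A B S H : Set V) : Prop where
  not_adj : ∀ a ∈ A, ∀ b ∈ B, ¬ G.Adj a b
  disjoint : Disjoint A B
  disjoint_left : Disjoint A S
  disjoint_right : Disjoint B S
  reach_left : ∀ a ∈ A, ∀ b ∈ A, Reach G A a b
  reach_right : ∀ a ∈ B, ∀ b ∈ B, Reach G B a b
  subset : ∀ h ∈ H, h ∈ A ∨ h ∈ B ∨ h ∈ S
  hole : IsLongHole G H
  left : ∃ h ∈ H, h ∈ A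
  right : ∃ h ∈ H, h ∈ B
  adj_left : ∀ σ ∈ H, σ ∈ S → ∃ h ∈ H, h ∈ A ∧ G.Adj σ h
  adj_right : ∀ σ ∈ H, σ ∈ S → ∃ h ∈ H, h ∈ B ∧ G.Adj σ h

variable {A B S H : Set V}

lemma IsFrame.symm (hF : IsFrame G A B S H) : IsFrame G B A S H where
  not_adj a ha b hb h := hF.not_adj b hb a ha h.symm
  disjoint := hF.disjoint.symm
  disjoint_left := hF.disjoint_right
  disjoint_right := hF.disjoint_left
  reach_left := hF.reach_right
  reach_right := hF.reach_left
  subset h hh := by rcases hF.subset h hh with h | h | h <;> simp [h]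
  hole := hF.hole
  left := hF.right
  right := hF.left
  adj_left := hF.adj_right
  adj_right := hF.adj_left

lemma IsFrame.notMem_right (hF : IsFrame G A B S H) {v : V} (hv : v ∈ A) : v ∉ B :=
  fun h => Set.disjoint_left.1 hF.disjoint hv h

lemma IsFrame.notMem_sep (hF : IsFrame G A B S H) {v : V} (hv : v ∈ A) : v ∉ S :=
  fun h => Set.disjoint_left.1 hF.disjoint_left hv h

lemma IsFrame.mem_left_of_twin (hF : IsFrame G A B S H) {x v : V} (hx : x ∈ H) (hv : v ∈ A)
    (htw : IsTwinOn G H x v) : x ∈ A := by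
  rcases hF.subset x hx with h | h | h
  · exact h
  · exact absurd ((htw x hx).2 (Or.inl rfl)) (hF.not_adj v hv x h)
  · obtain ⟨y, hy, hyB, hxy⟩ := hF.adj_right x hx h
    exact absurd ((htw y hy).2 (Or.inr hxy)) (hF.not_adj v hv y hyB)

lemma IsFrame.exists_not_adj (hF : IsFrame G A B S H) {v : V} (hv : v ∈ A) :
    ∃ h ∈ H, ¬ G.Adj v h := by
  obtain ⟨h, hh, hB⟩ := hF.right
  exact ⟨h, hh, hF.not_adj v hv h hB⟩

lemma IsLongHole.not_isTwinOn_of_single (hH : IsLongHole G H) {x v : V} (hx : x ∈ H)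
    (hv : ∀ h ∈ H, G.Adj v h ↔ h = x) : ¬ IsTwinOn G H x v := by
  intro htw
  obtain ⟨y, hy, hxy⟩ := hH.exists_adj hx
  exact hxy.ne ((hv y hy).1 ((htw y hy).2 (Or.inr hxy))).symm

lemma IsFrame.reach_insert (hF : IsFrame G A B S H) {s a h : V} (ha : a ∈ A) (hsa : G.Adj s a)
    (hh : h ∈ A) : Reach G (insert s A) s h :=
  (Reach.of_adj hsa (Or.inl rfl) (Or.inr ha)).trans
    ((hF.reach_left a ha h hh).mono (Set.subset_insert _ _))

lemma IsFrame.false_of_single (hF : IsFrame G A B S H)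
    (hG : ¬ ContainsInducedSubdivision house G) {s a x : V} (hsH : s ∉ H)
    (ha : a ∈ A) (hsa : G.Adj s a) (hx : x ∈ H) (hxA : x ∉ A)
    (hs : ∀ h ∈ H, G.Adj s h ↔ h = x) : False := by
  obtain ⟨h, hh, hhA⟩ := hF.left
  refine hF.hole.false_of_reach hG (E := insert s A) hx hsH hs ?_ (Or.inl rfl) hh
    (hF.reach_insert ha hsa hhA) ?_
  · rintro (rfl | h)
    · exact hsH hx
    · exact hxA h
  · rintro v (rfl | hv) hvH
    · refine ⟨⟨h, hh, fun hvh => ?_⟩, hF.hole.not_isTwinOn_of_single hx hs⟩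
      exact hxA ((hs h hh).1 hvh ▸ hhA)
    · exact ⟨hF.exists_not_adj hv, fun htw => hxA (hF.mem_left_of_twin hx hv htw)⟩

lemma IsFrame.false_of_twin (hF : IsFrame G A B S H)
    (hG : ¬ ContainsInducedSubdivision house G) {s b x : V} (hs : s ∈ S) (hsH : s ∉ H)
    (hb : b ∈ B) (hsb : G.Adj s b) (hx : x ∈ H) (hxA : x ∈ A) (htw : IsTwinOn G H x s) :
    False := by
  have hH' := hF.hole.replace hx hsH htw
  obtain ⟨h, hh, hhB⟩ := hF.right
  have hxB : x ∉ B := hF.notMem_right hxA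
  have hB : ∀ v ∈ B, v ∉ insert s (H \ {x}) → v ∉ H := fun v hv hv' hvH =>
    hv' (Or.inr ⟨hvH, fun h => hxB (h ▸ hv)⟩)
  have hnone : ∀ v ∈ B, v ∉ H → G.Adj v s → ∀ h ∈ H, ¬ G.Adj v h := fun v hv hvH hvs =>
    hF.hole.not_adj_of_adj_twin hG hx hsH htw hvH hvs fun h => hF.not_adj x hxA v hv h.symm
  have hbH : b ∉ H := fun hbH => by
    rcases (htw b hbH).1 hsb with rfl | h
    · exact hxB hb
    · exact hF.not_adj x hxA b hb h
  have hhx : h ≠ x := fun h => hxB (h ▸ hhB)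
  refine hH'.false_of_reach hG (E := B) (t := b) (Or.inl rfl) ?_ ?_ ?_ hb (Or.inr ⟨hh, hhx⟩)
    (hF.reach_right b hb h hhB) ?_
  · rintro (h | h)
    · exact hsb.ne h.symm
    · exact hbH h.1
  · rintro u (rfl | hu)
    · simp [hsb.symm]
    · refine ⟨fun h => absurd h (hnone b hb hbH hsb.symm u hu.1), ?_⟩
      rintro rfl
      exact absurd hu.1 hsH
  · exact fun h => hF.symm.notMem_sep h hs
  · intro v hv hv'
    have hvH := hB v hv hv'
    constructor
    · by_cases hvs : G.Adj v s
      · exact ⟨h, Or.inr ⟨hh, hhx⟩, hnone v hv hvH hvs h hh⟩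
      · exact ⟨s, Or.inl rfl, hvs⟩
    · intro htw'
      have hvs : G.Adj v s := (htw' s (Or.inl rfl)).2 (Or.inl rfl)
      obtain ⟨u, hu, hsu⟩ := hH'.exists_adj (Or.inl rfl : s ∈ insert s (H \ {x}))
      have huH : u ∈ H := by
        rcases hu with rfl | hu
        · exact absurd hsu (G.loopless.irrefl _)
        · exact hu.1
      exact hnone v hv hvH hvs u huH ((htw' u hu).2 (Or.inr hsu))

lemma IsFrame.false_of_none (hF : IsFrame G A B S H)
    (hG : ¬ ContainsInducedSubdivision house G) {s a b : V} (hsH : s ∉ H)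
    (ha : a ∈ A) (hsa : G.Adj s a) (hb : b ∈ B) (hsb : G.Adj s b)
    (hs : ∀ h ∈ H, ¬ G.Adj s h) : False := by
  obtain ⟨h, hh, hhA⟩ := hF.left
  obtain ⟨k, hk, hkB⟩ := hF.right
  obtain ⟨r', r, hsr, hr', hrP, hadj, -, hrE⟩ := (hF.reach_insert ha hsa hhA).exists_exit
    (P := {v | v ∉ H ∧ ∀ h ∈ H, ¬ G.Adj v h}) ⟨hsH, hs⟩ fun h => h.1 hh
  have hrA : r ∈ A := hrE.resolve_left fun h => hrP (h ▸ ⟨hsH, hs⟩)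
  have hrH : r ∉ H := fun h => hr'.2 r h hadj
  have hF' : Reach G (B ∪ (insert s A ∩ {v | v ∉ H ∧ ∀ h ∈ H, ¬ G.Adj v h})) r' k := by
    refine (hsr.symm.mono Set.subset_union_right).trans ?_
    refine (Reach.of_adj hsb (Or.inr ⟨Or.inl rfl, hsH, hs⟩) (Or.inl hb)).trans ?_
    exact (hF.reach_right b hb k hkB).mono Set.subset_union_left
  have hr'F : r' ∈ B ∪ (insert s A ∩ {v | v ∉ H ∧ ∀ h ∈ H, ¬ G.Adj v h}) := by
    refine Or.inr ⟨?_, hr'⟩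
    rcases Relation.ReflTransGen.cases_tail hsr with h | ⟨_, -, h⟩
    · exact Or.inl h
    · exact h.2.2.1
  rcases hF.hole.neighbors hG hrH with h1 | h1 | ⟨x, hx, h1⟩ | ⟨x, hx, h1⟩
  · exact hF.not_adj r hrA k hkB (h1 k hk)
  · exact hrP ⟨hrH, h1⟩
  · by_cases hxA : x ∈ A
    · have hxB := hF.notMem_right hxA
      refine hF.hole.false_of_reach hG
        (E := insert r (B ∪ (insert s A ∩ {v | v ∉ H ∧ ∀ h ∈ H, ¬ G.Adj v h}))) hx hrH h1 ?_
        (Or.inl rfl) hk ((Reach.of_adj hadj.symm (Or.inl rfl) (Or.inr hr'F)).trans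
          (hF'.mono (Set.subset_insert _ _))) ?_
      · rintro (rfl | h | h)
        · exact hrH hx
        · exact hxB h
        · exact h.2.1 hx
      · rintro v (rfl | hv | hv) hvH
        · exact ⟨hF.exists_not_adj hrA, hF.hole.not_isTwinOn_of_single hx h1⟩
        · exact ⟨hF.symm.exists_not_adj hv, fun htw => hxB (hF.symm.mem_left_of_twin hx hv htw)⟩
        · exact ⟨⟨x, hx, hv.2.2 x hx⟩, fun htw => hv.2.2 x hx ((htw x hx).2 (Or.inl rfl))⟩
    · refine hF.hole.false_of_reach hG (E := A) hx hrH h1 hxA hrA hh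
        (hF.reach_left r hrA h hhA) fun v hv hvH => ?_
      exact ⟨hF.exists_not_adj hv, fun htw => hxA (hF.mem_left_of_twin hx hv htw)⟩
  · have hxA := hF.mem_left_of_twin hx hrA h1
    have hxB := hF.notMem_right hxA
    have hkx : k ≠ x := fun h => hxB (h ▸ hkB)
    have hH' := hF.hole.replace hx hrH h1
    refine hH'.false_of_reach hG (Or.inl rfl) ?_ ?_ ?_ hr'F (Or.inr ⟨hk, hkx⟩) hF' ?_
    · rintro (h | h)
      · exact hadj.ne h
      · exact hr'.1 h.1
    · rintro u (rfl | hu)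
      · simp [hadj]
      · refine ⟨fun h => absurd h (hr'.2 u hu.1), ?_⟩
        rintro rfl
        exact absurd hu.1 hrH
    · rintro (h | h)
      · exact hF.notMem_right hrA h
      · exact hrP h.2
    · rintro v (hv | hv) hvH'
      · have hvr : ¬ G.Adj v r := fun h => hF.not_adj r hrA v hv h.symm
        exact ⟨⟨r, Or.inl rfl, hvr⟩, fun htw => hvr ((htw r (Or.inl rfl)).2 (Or.inl rfl))⟩
      · refine ⟨⟨k, Or.inr ⟨hk, hkx⟩, hv.2.2 k hk⟩, fun htw => ?_⟩
        obtain ⟨u, hu, hru⟩ := hH'.exists_adj (Or.inl rfl : r ∈ insert r (H \ {x}))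
        rcases hu with rfl | hu
        · exact G.loopless.irrefl _ hru
        · exact hv.2.2 u hu.1 ((htw u (Or.inr hu)).2 (Or.inr hru))

/-- A vertex of `S` outside the hole of a frame with neighbours on both sides is complete to the
hole or a twin of a hole vertex in `S`. -/
lemma IsFrame.complete_or_twin (hF : IsFrame G A B S H)
    (hG : ¬ ContainsInducedSubdivision house G) {s a b : V} (hs : s ∈ S) (hsH : s ∉ H)
    (ha : a ∈ A) (hsa : G.Adj s a) (hb : b ∈ B) (hsb : G.Adj s b) :
    (∀ h ∈ H, G.Adj s h) ∨ ∃ x ∈ H, x ∈ S ∧ IsTwinOn G H x s := by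
  rcases hF.hole.neighbors hG hsH with h | h | ⟨x, hx, h⟩ | ⟨x, hx, h⟩
  · exact Or.inl h
  · exact (hF.false_of_none hG hsH ha hsa hb hsb h).elim
  · by_cases hxA : x ∈ A
    · exact (hF.symm.false_of_single hG hsH hb hsb hx (hF.notMem_right hxA) h).elim
    · exact (hF.false_of_single hG hsH ha hsa hx hxA h).elim
  · rcases hF.subset x hx with hx' | hx' | hx'
    · exact (hF.false_of_twin hG hs hsH hb hsb hx hx' h).elim
    · exact (hF.symm.false_of_twin hG hs hsH ha hsa hx hx' h).elim
    · exact Or.inr ⟨x, hx, hx', h⟩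

end Frame

section Domination

variable {V : Type} {G : SimpleGraph V}

lemma isLongHoleMap_of_lt {n : ℕ} {c : ℕ → V} (hn : 5 ≤ n)
    (h : ∀ i k, i < k → k < n → c i ≠ c k ∧
      (G.Adj (c i) (c k) ↔ i + 1 = k ∨ (i = 0 ∧ k + 1 = n))) : IsLongHoleMap G n c := by
  refine ⟨hn, fun i hi k hk => ?_⟩
  rcases lt_trichotomy i k with hik | rfl | hik
  · have := h i k hik hk
    exact ⟨fun h' => absurd h' this.1, by rw [this.2]; omega⟩
  · simp
    omega
  · have := h k i hik hi
    exact ⟨fun h' => absurd h'.symm this.1, by rw [G.adj_comm, this.2]; omega⟩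

/-- Two nonadjacent vertices joined by two induced paths without edges between them, the first
with at least two vertices, form a long hole together with these paths. -/
lemma isLongHole_of_paths {s t : V} {j M : ℕ} {q b : ℕ → V} (hj : 1 ≤ j)
    (hst : s ≠ t) (hadj : ¬ G.Adj s t) (hq : IsInducedPath G j q) (hb : IsInducedPath G M b)
    (hsq : ∀ i ≤ j, q i ≠ s ∧ q i ≠ t ∧ (G.Adj s (q i) ↔ i = 0) ∧ (G.Adj t (q i) ↔ i = j))
    (hsb : ∀ i ≤ M, b i ≠ s ∧ b i ≠ t ∧ (G.Adj s (b i) ↔ i = 0) ∧ (G.Adj t (b i) ↔ i = M))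
    (hqb : ∀ i ≤ j, ∀ k ≤ M, q i ≠ b k ∧ ¬ G.Adj (q i) (b k)) :
    IsLongHole G {v | v = s ∨ v = t ∨ (∃ i ≤ j, q i = v) ∨ ∃ k ≤ M, b k = v} := by
  obtain ⟨c, hc0, hcq, hct, hcb⟩ : ∃ c : ℕ → V, c 0 = s ∧ (∀ i ≤ j, c (i + 1) = q i) ∧
      c (j + 2) = t ∧ ∀ k ≤ M, c (j + 3 + k) = b (M - k) := by
    refine ⟨fun i => if i = 0 then s else if i ≤ j + 1 then q (i - 1) else
      if i = j + 2 then t else b (M - (i - (j + 3))), by simp, ?_, by simp, ?_⟩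
    · intro i hi
      simp [hi]
    · intro k hk
      dsimp only
      rw [if_neg (by omega), if_neg (by omega), if_neg (by omega), Nat.add_sub_cancel_left]
  have hcase : ∀ i < j + M + 4, i = 0 ∨ (∃ i' ≤ j, i = i' + 1) ∨ i = j + 2 ∨
      ∃ k ≤ M, i = j + 3 + k := by
    intro i hi
    by_cases h1 : i ≤ j + 1
    · rcases Nat.eq_zero_or_pos i with h | h
      · exact Or.inl h
      · exact Or.inr (Or.inl ⟨i - 1, by omega, by omega⟩)
    · by_cases h2 : i = j + 2
      · exact Or.inr (Or.inr (Or.inl h2))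
      · exact Or.inr (Or.inr (Or.inr ⟨i - (j + 3), by omega, by omega⟩))
  refine ⟨j + M + 4, c, isLongHoleMap_of_lt (by omega) fun i k hik hk => ?_, fun v => ?_⟩
  · rcases hcase i (by omega) with rfl | ⟨i', hi', rfl⟩ | rfl | ⟨i', hi', rfl⟩ <;>
    rcases hcase k hk with rfl | ⟨k', hk', rfl⟩ | rfl | ⟨k', hk', rfl⟩
    · omega
    · have := hsq k' hk'
      rw [hc0, hcq k' hk', this.2.2.1]
      exact ⟨this.1.symm, by omega⟩
    · rw [hc0, hct]
      exact ⟨hst, iff_of_false hadj (by omega)⟩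
    · have := hsb (M - k') (by omega)
      rw [hc0, hcb k' hk', this.2.2.1]
      exact ⟨this.1.symm, by omega⟩
    · omega
    · have := hq i' hi' k' hk'
      rw [hcq i' hi', hcq k' hk', this.2]
      exact ⟨fun h => by have := this.1 h; omega, by omega⟩
    · have := hsq i' hi'
      rw [hcq i' hi', hct, G.adj_comm, this.2.2.2]
      exact ⟨this.2.1, by omega⟩
    · have := hqb i' hi' (M - k') (by omega)
      rw [hcq i' hi', hcb k' hk']
      exact ⟨this.1, iff_of_false this.2 (by omega)⟩
    · omega
    · omega
    · omega
    · have := hsb (M - k') (by omega)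
      rw [hct, hcb k' hk', this.2.2.2]
      exact ⟨this.2.1.symm, by omega⟩
    · omega
    · omega
    · omega
    · have := hb (M - i') (by omega) (M - k') (by omega)
      rw [hcb i' hi', hcb k' hk', this.2]
      exact ⟨fun h => by have := this.1 h; omega, by omega⟩
  · constructor
    · rintro (rfl | rfl | ⟨i, hi, rfl⟩ | ⟨i, hi, rfl⟩)
      · exact ⟨0, by omega, hc0⟩
      · exact ⟨j + 2, by omega, hct⟩
      · exact ⟨i + 1, by omega, hcq i hi⟩
      · refine ⟨j + 3 + (M - i), by omega, ?_⟩
        rw [hcb _ (by omega), Nat.sub_sub_self hi]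
    · rintro ⟨i, hi, rfl⟩
      rcases hcase i hi with rfl | ⟨i', hi', rfl⟩ | rfl | ⟨i', hi', rfl⟩
      · exact Or.inl hc0
      · exact Or.inr (Or.inr (Or.inl ⟨i', hi', (hcq i' hi').symm⟩))
      · exact Or.inr (Or.inl hct)
      · exact Or.inr (Or.inr (Or.inr ⟨M - i', by omega, (hcb i' hi').symm⟩))

/-- `A` and `B` are disjoint connected sets without edges between them, and each vertex of `S` has
neighbours in both. -/
structure IsFullCut (G : SimpleGraph V) (A B S : Set V) : Prop where
  not_adj : ∀ a ∈ A, ∀ b ∈ B, ¬ G.Adj a b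
  disjoint : Disjoint A B
  disjoint_left : Disjoint A S
  disjoint_right : Disjoint B S
  reach_left : ∀ a ∈ A, ∀ b ∈ A, Reach G A a b
  reach_right : ∀ a ∈ B, ∀ b ∈ B, Reach G B a b
  adj_left : ∀ s ∈ S, ∃ a ∈ A, G.Adj s a
  adj_right : ∀ s ∈ S, ∃ b ∈ B, G.Adj s b

variable {A B S : Set V}

/-- In a graph without induced subdivisions of the house, the vertices of a full cut are dominated
by at most two vertices of one side. -/
lemma IsFullCut.exists_dominating [Finite V] (hC : IsFullCut G A B S)
    (hG : ¬ ContainsInducedSubdivision house G) (hA : A.Nonempty) :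
    ∃ u ∈ A, ∃ v ∈ A, ∀ s ∈ S, G.Adj s u ∨ G.Adj s v := by
  obtain ⟨a, ha, hmax⟩ := Set.exists_max_image A (fun a => {s ∈ S | G.Adj s a}.ncard)
    (Set.toFinite A) hA
  by_cases hdom : ∀ s ∈ S, G.Adj s a
  · exact ⟨a, ha, a, ha, fun s hs => Or.inl (hdom s hs)⟩
  push Not at hdom
  obtain ⟨s, hs, hsa⟩ := hdom
  have hSA : ∀ {x y}, x ∈ A → y ∈ S → x ≠ y := fun hx hy h =>
    Set.disjoint_left.1 hC.disjoint_left hx (h ▸ hy)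
  have hSB : ∀ {x y}, x ∈ B → y ∈ S → x ≠ y := fun hx hy h =>
    Set.disjoint_left.1 hC.disjoint_right hx (h ▸ hy)
  have hAB : ∀ {x y}, x ∈ A → y ∈ B → x ≠ y := fun hx hy h =>
    Set.disjoint_left.1 hC.disjoint hx (h ▸ hy)
  obtain ⟨w, hw, hsw⟩ := hC.adj_left s hs
  obtain ⟨L, q, hq0, rfl, hqA, hq, hqX, -⟩ := (hC.reach_left w hw a ha).exists_inducedPath
    (X := fun v => G.Adj s v) (Y := fun v => v = a) hw hsw rfl
  obtain ⟨t, ht, hta, htq0⟩ : ∃ t ∈ S, G.Adj t (q L) ∧ ¬ G.Adj t (q 0) := by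
    by_contra! hcon
    have hlt : {s ∈ S | G.Adj s (q L)}.ncard < {s ∈ S | G.Adj s (q 0)}.ncard := by
      refine Set.ncard_lt_ncard ⟨fun u hu => ⟨hu.1, hcon u hu.1 hu.2⟩, fun h => ?_⟩ (Set.toFinite _)
      exact hsa (h ⟨hs, hq0⟩).2
    exact hlt.not_ge (hmax _ (hqA 0 (by omega)))
  have hst : s ≠ t := by
    rintro rfl
    exact hsa hta
  obtain ⟨j, hjL, htj, hjmin⟩ : ∃ j ≤ L, G.Adj t (q j) ∧ ∀ i < j, ¬ G.Adj t (q i) := by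
    classical
    have hex : ∃ j, G.Adj t (q j) := ⟨L, hta⟩
    exact ⟨Nat.find hex, Nat.find_min' hex hta, Nat.find_spec hex, fun i hi => Nat.find_min hex hi⟩
  have hj : 1 ≤ j := Nat.one_le_iff_ne_zero.2 fun h => htq0 (h ▸ htj)
  have hsq : ∀ i ≤ j, q i ≠ s ∧ q i ≠ t ∧ (G.Adj s (q i) ↔ i = 0) ∧
      (G.Adj t (q i) ↔ i = j) := by
    intro i hi
    have hiA := hqA i (by omega)
    refine ⟨hSA hiA hs, hSA hiA ht, ⟨hqX i (by omega), fun h => h ▸ hq0⟩, fun h => ?_,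
      fun h => h ▸ htj⟩
    by_contra hne
    exact hjmin i (by omega) h
  have hqj : IsInducedPath G j q := fun i hi k hk => hq i (by omega) k (by omega)
  obtain ⟨y, hy, hsy⟩ := hC.adj_right s hs
  obtain ⟨z, hz, htz⟩ := hC.adj_right t ht
  obtain ⟨M, b, hb0, hbM, hbB, hb, hbX, hbY⟩ := (hC.reach_right y hy z hz).exists_inducedPath
    (X := fun v => G.Adj s v) (Y := fun v => G.Adj t v) hy hsy htz
  have hsb : ∀ i ≤ M, b i ≠ s ∧ b i ≠ t ∧ (G.Adj s (b i) ↔ i = 0) ∧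
      (G.Adj t (b i) ↔ i = M) := fun i hi =>
    ⟨hSB (hbB i hi) hs, hSB (hbB i hi) ht, ⟨hbX i hi, fun h => h ▸ hb0⟩,
      ⟨hbY i hi, fun h => h ▸ hbM⟩⟩
  have hqb : ∀ i ≤ j, ∀ k ≤ M, q i ≠ b k ∧ ¬ G.Adj (q i) (b k) := fun i hi k hk =>
    ⟨hAB (hqA i (by omega)) (hbB k hk), hC.not_adj _ (hqA i (by omega)) _ (hbB k hk)⟩
  have hadj : ¬ G.Adj s t := fun h => hG (house_of_unichord hj h hb hqj hsb hsq
    fun i hi k hk => ⟨(hqb k hk i hi).1.symm, fun h' => (hqb k hk i hi).2 h'.symm⟩)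
  have hHS : ∀ σ ∈ {v | v = s ∨ v = t ∨ (∃ i ≤ j, q i = v) ∨ ∃ k ≤ M, b k = v}, σ ∈ S →
      σ = s ∨ σ = t := by
    rintro σ (h | h | ⟨i, hi, rfl⟩ | ⟨k, hk, rfl⟩) hσ
    · exact Or.inl h
    · exact Or.inr h
    · exact absurd rfl (hSA (hqA i (by omega)) hσ)
    · exact absurd rfl (hSB (hbB k hk) hσ)
  have hqH : ∀ i ≤ j, q i ∈ {v | v = s ∨ v = t ∨ (∃ i ≤ j, q i = v) ∨ ∃ k ≤ M, b k = v} :=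
    fun i hi => Or.inr (Or.inr (Or.inl ⟨i, hi, rfl⟩))
  have hbH : ∀ k ≤ M, b k ∈ {v | v = s ∨ v = t ∨ (∃ i ≤ j, q i = v) ∨ ∃ k ≤ M, b k = v} :=
    fun k hk => Or.inr (Or.inr (Or.inr ⟨k, hk, rfl⟩))
  have hF : IsFrame G A B S {v | v = s ∨ v = t ∨ (∃ i ≤ j, q i = v) ∨ ∃ k ≤ M, b k = v} :=
    { not_adj := hC.not_adj
      disjoint := hC.disjoint
      disjoint_left := hC.disjoint_left
      disjoint_right := hC.disjoint_right
      reach_left := hC.reach_left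
      reach_right := hC.reach_right
      subset := by
        rintro h (rfl | rfl | ⟨i, hi, rfl⟩ | ⟨k, hk, rfl⟩)
        · exact Or.inr (Or.inr hs)
        · exact Or.inr (Or.inr ht)
        · exact Or.inl (hqA i (by omega))
        · exact Or.inr (Or.inl (hbB k hk))
      hole := isLongHole_of_paths hj hst hadj hqj hb hsq hsb hqb
      left := ⟨q 0, hqH 0 (by omega), hqA 0 (by omega)⟩
      right := ⟨b 0, hbH 0 (by omega), hbB 0 (by omega)⟩
      adj_left := by
        intro σ hσH hσ
        rcases hHS σ hσH hσ with rfl | rfl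
        · exact ⟨q 0, hqH 0 (by omega), hqA 0 (by omega), hq0⟩
        · exact ⟨q j, hqH j le_rfl, hqA j hjL, htj⟩
      adj_right := by
        intro σ hσH hσ
        rcases hHS σ hσH hσ with rfl | rfl
        · exact ⟨b 0, hbH 0 (by omega), hbB 0 (by omega), hb0⟩
        · exact ⟨b M, hbH M le_rfl, hbB M le_rfl, hbM⟩ }
  refine ⟨q 0, hqA 0 (by omega), q j, hqA j hjL, fun σ hσ => ?_⟩
  by_cases hσH : σ ∈ {v | v = s ∨ v = t ∨ (∃ i ≤ j, q i = v) ∨ ∃ k ≤ M, b k = v}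
  · rcases hHS σ hσH hσ with rfl | rfl
    · exact Or.inl hq0
    · exact Or.inr htj
  · obtain ⟨x, hx, hσx⟩ := hC.adj_left σ hσ
    obtain ⟨u, hu, hσu⟩ := hC.adj_right σ hσ
    rcases hF.complete_or_twin hG hσ hσH hx hσx hu hσu with h | ⟨w, hwH, hwS, h⟩
    · exact Or.inl (h _ (hqH 0 (by omega)))
    · rcases hHS w hwH hwS with rfl | rfl
      · exact Or.inl ((h _ (hqH 0 (by omega))).2 (Or.inr hq0))
      · exact Or.inr ((h _ (hqH j le_rfl)).2 (Or.inr htj))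

end Domination

section Separators

variable {V : Type} {G : SimpleGraph V}

lemma Reach.mem {E : Set V} {u v : V} (h : Reach G E u v) (hu : u ∈ E) : v ∈ E := by
  rcases Relation.ReflTransGen.cases_tail h with h | ⟨_, -, h⟩
  · exact h ▸ hu
  · exact h.2.2

lemma Reach.reach_component {E : Set V} {u v : V} (h : Reach G E u v) :
    Reach G {w | Reach G E u w} u v := by
  induction h with
  | refl => exact Relation.ReflTransGen.refl
  | tail h h' ih => exact Relation.ReflTransGen.tail ih ⟨h'.1, h, Relation.ReflTransGen.tail h h'⟩

lemma separates_iff_not_reach {S : Set V} {a b : V} (ha : a ∉ S) :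
    Separates G S a b ↔ ¬ Reach G Sᶜ a b := by
  constructor
  · intro h hr
    have : ∃ p : G.Walk a b, ∀ x ∈ p.support, x ∉ S := by
      clear h
      revert ha
      induction hr using Relation.ReflTransGen.head_induction_on with
      | refl => exact fun hb => ⟨Walk.nil, by simpa using hb⟩
      | head h _ ih =>
        intro ha
        obtain ⟨p, hp⟩ := ih h.2.2
        exact ⟨Walk.cons h.1 p, by simpa using ⟨ha, hp⟩⟩
    obtain ⟨p, hp⟩ := this
    obtain ⟨x, hx, hxS⟩ := h p
    exact hp x hx hxS
  · intro h p
    by_contra! hp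
    apply h
    clear h
    induction p with
    | nil => exact Relation.ReflTransGen.refl
    | cons h p ih =>
      simp only [Walk.support_cons, List.mem_cons, forall_eq_or_imp] at hp
      have := hp.2 _ p.start_mem_support
      exact Relation.ReflTransGen.head ⟨h, hp.1, this⟩ (ih this hp.2)

lemma exists_adj_of_reach {S : Set V} {s a b : V} (hab : ¬ Reach G Sᶜ a b) (ha : a ∉ S)
    (h : Reach G (S \ {s})ᶜ a b) : ∃ x ∈ {v | Reach G Sᶜ a v}, G.Adj s x := by
  obtain ⟨r', r, -, hr', hr, hadj, -, hrS⟩ := h.exists_exit (P := {v | Reach G Sᶜ a v})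
    Relation.ReflTransGen.refl hab
  have hrS' : r ∈ S := by
    by_contra hrS'
    exact hr (Relation.ReflTransGen.tail hr' ⟨hadj, Reach.mem hr' ha, hrS'⟩)
  have hrs : r = s := by
    by_contra hne
    exact hrS ⟨hrS', hne⟩
  exact ⟨r', hr', hrs ▸ hadj.symm⟩

/-- The two components of a minimal separator separating a given pair form a full cut. -/
lemma IsMinimalSeparator.exists_isFullCut {S : Set V} (hS : IsMinimalSeparator G S) :
    ∃ a b, a ∉ S ∧ b ∉ S ∧ IsFullCut G {v | Reach G Sᶜ a v} {v | Reach G Sᶜ b v} S := by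
  obtain ⟨a, b, ha, hb, -, -, hsep, hmin⟩ := hS
  have hab := (separates_iff_not_reach ha).1 hsep
  have hdel : ∀ s ∈ S, Reach G (S \ {s})ᶜ a b := by
    intro s hs
    have h := hmin (S \ {s}) (Set.sdiff_singleton_ssubset.2 hs)
    rw [separates_iff_not_reach fun h => ha h.1] at h
    exact not_not.1 h
  have hconn : ∀ u, ∀ v ∈ {v | Reach G Sᶜ u v}, ∀ w ∈ {v | Reach G Sᶜ u v},
      Reach G {v | Reach G Sᶜ u v} v w := fun u v hv w hw =>
    (Reach.reach_component hv).symm.trans (Reach.reach_component hw)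
  refine ⟨a, b, ha, hb, ?_, ?_, ?_, ?_, hconn a, hconn b, ?_, ?_⟩
  · intro u hu v hv huv
    exact hab ((hu.tail ⟨huv, Reach.mem hu ha, Reach.mem hv hb⟩).trans hv.symm)
  · exact Set.disjoint_left.2 fun u hu hv => hab (Reach.trans hu hv.symm)
  · exact Set.disjoint_left.2 fun u hu => Reach.mem hu ha
  · exact Set.disjoint_left.2 fun u hu => Reach.mem hu hb
  · exact fun s hs => exists_adj_of_reach hab ha (hdel s hs)
  · exact fun s hs => exists_adj_of_reach (fun h => hab h.symm) hb (hdel s hs).symm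

/-- The vertices outside the component of `b` in `G - (N(u) ∪ N(v))` with a neighbour in it. -/
def componentBoundary (G : SimpleGraph V) (u v b : V) : Set V :=
  {w | ¬ Reach G {x | ¬ G.Adj x u ∧ ¬ G.Adj x v} b w ∧
    ∃ x, Reach G {x | ¬ G.Adj x u ∧ ¬ G.Adj x v} b x ∧ G.Adj w x}

lemma IsMinimalSeparator.exists_eq_componentBoundary [Finite V] {S : Set V}
    (hS : IsMinimalSeparator G S) (hG : ¬ ContainsInducedSubdivision house G) :
    ∃ u v b, componentBoundary G u v b = S := by
  obtain ⟨a, b, ha, hb, hC⟩ := hS.exists_isFullCut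
  obtain ⟨u, hu, v, hv, hdom⟩ := hC.exists_dominating hG ⟨a, Relation.ReflTransGen.refl⟩
  have hreach : ∀ w, Reach G {x | ¬ G.Adj x u ∧ ¬ G.Adj x v} b w ↔ Reach G Sᶜ b w := by
    refine fun w => ⟨fun h => h.mono fun x hx hxS => ?_, fun h => h.reach_component.mono ?_⟩
    · exact (hdom x hxS).elim hx.1 hx.2
    · exact fun x hx =>
        ⟨fun h => hC.not_adj u hu x hx h.symm, fun h => hC.not_adj v hv x hx h.symm⟩
  refine ⟨u, v, b, ?_⟩
  ext w
  simp only [componentBoundary, hreach, Set.mem_ofPred_eq]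
  constructor
  · rintro ⟨hw, x, hx, hwx⟩
    by_contra hwS
    exact hw (hx.tail ⟨hwx.symm, hx.mem hb, hwS⟩)
  · exact fun hw => ⟨fun h => h.mem hb hw, hC.adj_right w hw⟩

lemma numMinSep_le {n : ℕ} {G : SimpleGraph (Fin n)}
    (hG : ¬ ContainsInducedSubdivision house G) : numMinSep G ≤ n ^ 3 := by
  have hsub : {S : Set (Fin n) | IsMinimalSeparator G S} ⊆
      (fun t : Fin n × Fin n × Fin n => componentBoundary G t.1 t.2.1 t.2.2) '' Set.univ := by
    intro S hS
    obtain ⟨u, v, b, h⟩ := hS.exists_eq_componentBoundary hG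
    exact ⟨(u, v, b), trivial, h⟩
  calc numMinSep G ≤ _ := Set.ncard_le_ncard hsub (Set.toFinite _)
    _ ≤ _ := Set.ncard_image_le (Set.toFinite _)
    _ = n ^ 3 := by
      rw [Set.ncard_univ, Nat.card_eq_fintype_card]
      simp only [Fintype.card_prod, Fintype.card_fin]
      ring

end Separators

theorem house_subdivision_free_tame :
    Tame (fun n (G : SimpleGraph (Fin n)) => ¬ ContainsInducedSubdivision house G) := by
  refine ⟨Polynomial.X ^ 3, fun n G hG => ?_⟩
  simpa using numMinSep_le hG
end
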